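/- Let 1 < p < ∞ and let Ω ⊆ ℝ² be a nonempty open set. Let φ_n : Ω → ℝ (n = 1, 2, ...) be p-harmonic functions on Ω converging locally uniformly on Ω to a function φ : Ω → ℝ. Then φ is p-harmonic on Ω and the gradients ∇φ_n converge to ∇φ locally uniformly on Ω. -/

import Mathlib

open MeasureTheory Set Filter
open scoped RealInnerProductSpace

/-- `φ` is `p`-harmonic on the open set `Ω ⊆ ℝ²`: it is `C¹` on `Ω` and satisfies the
weak form of `div(‖∇φ‖^{p-2} ∇φ) = 0` against all compactly supported `C¹` test
functions supported in `Ω`. -/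
def PHarmonicOn (p : ℝ) (Ω : Set (EuclideanSpace ℝ (Fin 2)))
    (φ : EuclideanSpace ℝ (Fin 2) → ℝ) : Prop :=
  ContDiffOn ℝ 1 φ Ω ∧
  ∀ η : EuclideanSpace ℝ (Fin 2) → ℝ, ContDiff ℝ 1 η → HasCompactSupport η →
    tsupport η ⊆ Ω →
    ∫ x in Ω, ‖gradient φ x‖ ^ (p - 2) * ⟪gradient φ x, gradient η x⟫ = 0

section Flux

variable {V : Type*} [NormedAddCommGroup V] [InnerProductSpace ℝ V]

/-- The flux `a ↦ ‖a‖^(p-2) a` of the `p`-Laplace operator. -/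
noncomputable def pFlux (p : ℝ) (a : V) : V := ‖a‖ ^ (p - 2) • a

@[simp]
theorem pFlux_zero (p : ℝ) : pFlux p (0 : V) = 0 := by simp [pFlux]

theorem norm_pFlux {p : ℝ} (hp : 1 < p) (a : V) : ‖pFlux p a‖ = ‖a‖ ^ (p - 1) := by
  rcases eq_or_ne a 0 with rfl | ha
  · rw [pFlux_zero, norm_zero, Real.zero_rpow (by linarith)]
  · have h : 0 < ‖a‖ := norm_pos_iff.2 ha
    rw [pFlux, norm_smul, Real.norm_of_nonneg (by positivity), ← Real.rpow_add_one h.ne']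
    congr 1; ring

theorem norm_pFlux_le_one {p : ℝ} (hp : 1 < p) {a : V} (ha : ‖a‖ ≤ 1) : ‖pFlux p a‖ ≤ 1 := by
  rw [norm_pFlux hp]
  exact Real.rpow_le_one (norm_nonneg _) ha (by linarith)

/-- The fluxes of conjugate exponents are inverse to each other. -/
theorem pFlux_pFlux {p q : ℝ} (hp : 1 < p) (hpq : (p - 1) * (q - 1) = 1) (a : V) :
    pFlux q (pFlux p a) = a := by
  rcases eq_or_ne a 0 with rfl | ha
  · simp
  · have h : 0 < ‖a‖ := norm_pos_iff.2 ha
    rw [pFlux, norm_pFlux hp, pFlux, smul_smul, ← Real.rpow_mul h.le, ← Real.rpow_add h,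
      show (p - 1) * (q - 2) + (p - 2) = 0 by linarith, Real.rpow_zero, one_smul]

theorem pFlux_smul {p : ℝ} {c : ℝ} (hc : 0 ≤ c) (a : V) :
    pFlux p (c • a) = (c ^ (p - 2) * c) • pFlux p a := by
  simp only [pFlux, norm_smul, Real.norm_of_nonneg hc, smul_smul]
  rw [Real.mul_rpow hc (norm_nonneg _)]
  congr 1; ring

theorem continuous_pFlux {p : ℝ} (hp : 1 < p) : Continuous (pFlux p : V → V) := by
  rw [continuous_iff_continuousAt]
  intro a
  rcases eq_or_ne a 0 with rfl | ha
  · rw [ContinuousAt, pFlux_zero, tendsto_zero_iff_norm_tendsto_zero]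
    simp only [norm_pFlux hp]
    have h : Continuous fun x : V => ‖x‖ ^ (p - 1) :=
      continuous_norm.rpow_const fun _ => Or.inr (by linarith)
    have := h.tendsto 0
    rwa [norm_zero, Real.zero_rpow (by linarith)] at this
  · exact (continuous_norm.continuousAt.rpow_const (Or.inl (norm_ne_zero_iff.2 ha))).smul
      continuousAt_id

theorem rpow_sub_one_mul_le {p : ℝ} (hp : 1 < p) (hp2 : p ≤ 2) {s t : ℝ} (ht : 0 ≤ t)
    (hts : t ≤ s) (hs : s ≤ 1) : (p - 1) * (s - t) ≤ s ^ (p - 1) - t ^ (p - 1) := by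
  rcases hts.eq_or_lt with rfl | hlt
  · simp
  have hs0 : 0 < s := ht.trans_lt hlt
  have h := rpow_one_add_le_one_add_mul_self (s := t / s - 1)
    (by linarith [div_nonneg ht hs0.le]) (p := p - 1) (by linarith) (by linarith)
  rw [show 1 + (t / s - 1) = t / s by ring, Real.div_rpow ht hs0.le] at h
  have hsp : 0 < s ^ (p - 1) := Real.rpow_pos_of_pos hs0 _
  rw [div_le_iff₀ hsp] at h
  have h1 : s ≤ s ^ (p - 1) := by
    simpa using Real.rpow_le_rpow_of_exponent_ge hs0 hs (by linarith : p - 1 ≤ 1)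
  have h2 : (p - 1) * (s - t) ≤ (p - 1) * ((1 - t / s) * s ^ (p - 1)) := by
    apply mul_le_mul_of_nonneg_left _ (by linarith)
    calc s - t = (1 - t / s) * s := by field_simp
      _ ≤ _ := by
        apply mul_le_mul_of_nonneg_left h1
        rw [sub_nonneg, div_le_one hs0]; exact hts
  nlinarith

theorem inner_pFlux_sub {p : ℝ} (hp : 1 < p) (hp2 : p ≤ 2) {a b : V} (ha : ‖a‖ ≤ 1)
    (hb : ‖b‖ ≤ 1) : (p - 1) * ‖a - b‖ ^ 2 ≤ ⟪pFlux p a - pFlux p b, a - b⟫ := by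
  have key : ∀ a : V, ‖a‖ ≤ 1 → (p - 1) * ‖a‖ ^ 2 ≤ ⟪pFlux p a, a⟫ := by
    intro a ha
    have h := rpow_sub_one_mul_le hp hp2 le_rfl (norm_nonneg a) ha
    rw [Real.zero_rpow (by linarith), ← norm_pFlux hp] at h
    have : ⟪pFlux p a, a⟫ = ‖pFlux p a‖ * ‖a‖ := by
      rw [pFlux, real_inner_smul_left, norm_smul, real_inner_self_eq_norm_sq,
        Real.norm_of_nonneg (by positivity)]; ring
    rw [this]
    nlinarith [norm_nonneg a]
  rcases eq_or_ne a 0 with rfl | ha0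
  · simpa using key b hb
  rcases eq_or_ne b 0 with rfl | hb0
  · simpa using key a ha
  have hs : 0 < ‖a‖ := norm_pos_iff.2 ha0
  have ht : 0 < ‖b‖ := norm_pos_iff.2 hb0
  have hs1 : 1 ≤ ‖a‖ ^ (p - 2) := Real.one_le_rpow_of_pos_of_le_one_of_nonpos hs ha (by linarith)
  have ht1 : 1 ≤ ‖b‖ ^ (p - 2) := Real.one_le_rpow_of_pos_of_le_one_of_nonpos ht hb (by linarith)
  have hsp : ‖a‖ ^ (p - 1) = ‖a‖ ^ (p - 2) * ‖a‖ := by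
    rw [← Real.rpow_add_one hs.ne']; congr 1; ring
  have htp : ‖b‖ ^ (p - 1) = ‖b‖ ^ (p - 2) * ‖b‖ := by
    rw [← Real.rpow_add_one ht.ne']; congr 1; ring
  have hcs : ⟪a, b⟫ ≤ ‖a‖ * ‖b‖ := real_inner_le_norm a b
  have hmon : (p - 1) * (‖a‖ - ‖b‖) ^ 2
      ≤ (‖a‖ ^ (p - 1) - ‖b‖ ^ (p - 1)) * (‖a‖ - ‖b‖) := by
    rcases le_total ‖b‖ ‖a‖ with h | h
    · have := rpow_sub_one_mul_le hp hp2 ht.le h ha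
      nlinarith
    · have := rpow_sub_one_mul_le hp hp2 hs.le h hb
      nlinarith
  rw [hsp, htp] at hmon
  have e1 : ‖a - b‖ ^ 2 = ‖a‖ ^ 2 - 2 * ⟪a, b⟫ + ‖b‖ ^ 2 := norm_sub_sq_real a b
  have e2 : ⟪pFlux p a - pFlux p b, a - b⟫ = ‖a‖ ^ (p - 2) * ‖a‖ ^ 2 + ‖b‖ ^ (p - 2) * ‖b‖ ^ 2
      - (‖a‖ ^ (p - 2) + ‖b‖ ^ (p - 2)) * ⟪a, b⟫ := by
    simp only [pFlux, inner_sub_left, inner_sub_right, real_inner_smul_left,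
      real_inner_self_eq_norm_sq, real_inner_comm a b]
    ring
  rw [e1, e2]
  have hc : 0 ≤ (‖a‖ ^ (p - 2) + ‖b‖ ^ (p - 2) - 2 * (p - 1)) * (‖a‖ * ‖b‖ - ⟪a, b⟫) :=
    mul_nonneg (by linarith) (by linarith)
  nlinarith

theorem norm_pFlux_sub_sq_le {p : ℝ} (hp2 : 2 ≤ p) {a b : V} (ha : ‖a‖ ≤ 1)
    (hb : ‖b‖ ≤ 1) :
    ‖pFlux p a - pFlux p b‖ ^ 2 ≤ (p - 1) * ⟪pFlux p a - pFlux p b, a - b⟫ := by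
  have hp : 1 < p := by linarith
  have hp0 : 0 < p - 1 := by linarith
  obtain ⟨q, hq⟩ : ∃ q, (p - 1) * (q - 1) = 1 := ⟨1 + (p - 1)⁻¹, by field_simp; ring⟩
  have hq1 : 1 < q := by nlinarith
  have hq2 : q ≤ 2 := by nlinarith
  have h := inner_pFlux_sub hq1 hq2 (norm_pFlux_le_one hp ha) (norm_pFlux_le_one hp hb)
  rw [pFlux_pFlux hp hq, pFlux_pFlux hp hq, real_inner_comm] at h
  calc ‖pFlux p a - pFlux p b‖ ^ 2
      = (p - 1) * ((q - 1) * ‖pFlux p a - pFlux p b‖ ^ 2) := by rw [← mul_assoc, hq, one_mul]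
    _ ≤ _ := mul_le_mul_of_nonneg_left h hp0.le

/-- Strict monotonicity of the flux. -/
theorem inner_pFlux_sub_nonneg {p : ℝ} (hp : 1 < p) (a b : V) :
    0 ≤ ⟪pFlux p a - pFlux p b, a - b⟫ ∧ (⟪pFlux p a - pFlux p b, a - b⟫ = 0 → a = b) := by
  obtain ⟨c, hc, ha, hb⟩ : ∃ c : ℝ, 0 < c ∧ ‖c • a‖ ≤ 1 ∧ ‖c • b‖ ≤ 1 := by
    have h : 0 < 1 + ‖a‖ + ‖b‖ := by positivity
    refine ⟨(1 + ‖a‖ + ‖b‖)⁻¹, by positivity, ?_, ?_⟩ <;>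
    · rw [norm_smul, norm_inv, Real.norm_of_nonneg h.le, inv_mul_le_one₀ h]
      linarith [norm_nonneg a, norm_nonneg b]
  have hk : 0 < c ^ (p - 2) * c * c := by positivity
  have e : ⟪pFlux p (c • a) - pFlux p (c • b), c • a - c • b⟫
      = (c ^ (p - 2) * c * c) * ⟪pFlux p a - pFlux p b, a - b⟫ := by
    rw [pFlux_smul hc.le, pFlux_smul hc.le, ← smul_sub, ← smul_sub, real_inner_smul_left,
      real_inner_smul_right]
    ring
  have key : 0 ≤ ⟪pFlux p (c • a) - pFlux p (c • b), c • a - c • b⟫ ∧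
      (⟪pFlux p (c • a) - pFlux p (c • b), c • a - c • b⟫ = 0 → c • a = c • b) := by
    rcases le_total p 2 with h2 | h2
    · have h := inner_pFlux_sub hp h2 ha hb
      have hp0 : 0 < p - 1 := by linarith
      refine ⟨le_trans (by positivity) h, fun h0 => ?_⟩
      rw [h0] at h
      have : ‖c • a - c • b‖ ^ 2 ≤ 0 := by nlinarith
      exact sub_eq_zero.1 (norm_eq_zero.1 (pow_eq_zero_iff two_ne_zero |>.1
        (le_antisymm this (sq_nonneg _))))
    · have h := norm_pFlux_sub_sq_le h2 ha hb
      have hp0 : 0 < p - 1 := by linarith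
      refine ⟨by nlinarith [sq_nonneg ‖pFlux p (c • a) - pFlux p (c • b)‖], fun h0 => ?_⟩
      rw [h0, mul_zero] at h
      have hF : pFlux p (c • a) = pFlux p (c • b) :=
        sub_eq_zero.1 (norm_eq_zero.1 (pow_eq_zero_iff two_ne_zero |>.1
          (le_antisymm h (sq_nonneg _))))
      have hq : (p - 1) * ((1 + (p - 1)⁻¹) - 1) = 1 := by field_simp; ring
      rw [← pFlux_pFlux hp hq (c • a), hF, pFlux_pFlux hp hq]
  rw [e] at key
  refine ⟨nonneg_of_mul_nonneg_right key.1 hk, fun h0 => ?_⟩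
  exact smul_right_injective V hc.ne' (key.2 (by rw [h0, mul_zero]))

end Flux

section Gradient

variable {V : Type*} [NormedAddCommGroup V] [InnerProductSpace ℝ V] [CompleteSpace V]
  {f g : V → ℝ} {f' g' x : V}

theorem HasGradientAt.fun_sub' (hf : HasGradientAt f f' x) (hg : HasGradientAt g g' x) :
    HasGradientAt (fun y => f y - g y) (f' - g') x := by
  rw [hasGradientAt_iff_hasFDerivAt, map_sub]
  exact hf.hasFDerivAt.sub hg.hasFDerivAt

theorem HasGradientAt.fun_mul' (hf : HasGradientAt f f' x) (hg : HasGradientAt g g' x) :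
    HasGradientAt (fun y => f y * g y) (f x • g' + g x • f') x := by
  rw [hasGradientAt_iff_hasFDerivAt, map_add, map_smulₛₗ, map_smulₛₗ]
  exact hf.hasFDerivAt.mul hg.hasFDerivAt

theorem HasDerivAt.comp_hasGradientAt {θ : ℝ → ℝ} {θ' : ℝ} (hθ : HasDerivAt θ θ' (f x))
    (hf : HasGradientAt f f' x) : HasGradientAt (fun y => θ (f y)) (θ' • f') x := by
  rw [hasGradientAt_iff_hasFDerivAt, map_smulₛₗ]
  exact hθ.comp_hasFDerivAt x hf.hasFDerivAt

theorem gradient_of_notMem_tsupport (h : x ∉ tsupport f) : gradient f x = 0 := by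
  rw [gradient, fderiv_of_notMem_tsupport ℝ h, map_zero]

theorem ContDiffOn.continuousOn_gradient {U : Set V} (hf : ContDiffOn ℝ 1 f U) (hU : IsOpen U) :
    ContinuousOn (gradient f) U :=
  (InnerProductSpace.toDual ℝ V).symm.continuous.comp_continuousOn
    (hf.continuousOn_fderiv_of_isOpen hU le_rfl)

theorem ContDiff.continuous_gradient (hf : ContDiff ℝ 1 f) : Continuous (gradient f) :=
  (InnerProductSpace.toDual ℝ V).symm.continuous.comp (hf.continuous_fderiv one_ne_zero)

theorem ContDiffOn.hasGradientAt {U : Set V} (hf : ContDiffOn ℝ 1 f U) (hU : IsOpen U)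
    (hx : x ∈ U) : HasGradientAt f (gradient f x) x :=
  ((hf.differentiableOn one_ne_zero).differentiableAt (hU.mem_nhds hx)).hasGradientAt

theorem ContDiff.hasGradientAt (hf : ContDiff ℝ 1 f) (x : V) :
    HasGradientAt f (gradient f x) x :=
  (hf.differentiable one_ne_zero x).hasGradientAt

theorem gradient_comp_affine (f : V → ℝ) (a x : V) (s : ℝ) :
    gradient (fun y => f (a + s • y)) x = s • gradient f (a + s • x) := by
  have h : fderiv ℝ (fun y => f (a + s • y)) x = s • fderiv ℝ f (a + s • x) := by
    have h1 := fderiv_comp_smul (𝕜 := ℝ) (f := fun z => f (a + z)) (x := x) s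
    rwa [fderiv_comp_add_left] at h1
  rw [gradient, h, map_smulₛₗ]
  rfl

theorem gradient_const_mul (c : ℝ) (f : V → ℝ) (x : V) :
    gradient (fun y => c * f y) x = c • gradient f x := by
  have h : fderiv ℝ (fun y => c * f y) x = c • fderiv ℝ f x := by
    rw [show (fun y => c * f y) = c • f from rfl, fderiv_const_smul_field]
    rfl
  rw [gradient, h, map_smulₛₗ]
  rfl

end Gradient

section CompactSupport

variable {X F : Type*} [TopologicalSpace X] [NormedAddCommGroup F] {f : X → F} {U K : Set X}

theorem ContinuousOn.continuous_of_eq_zero (hf : ContinuousOn f U) (hU : IsOpen U)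
    (hK : IsClosed K) (hKU : K ⊆ U) (h0 : ∀ x, x ∉ K → f x = 0) : Continuous f :=
  continuous_of_tsupport fun _ hx => hf.continuousAt <| hU.mem_nhds <| hKU <|
    closure_minimal (fun y (hy : f y ≠ 0) => by_contra fun hyK => hy (h0 y hyK)) hK hx

theorem ContinuousOn.integrable_of_eq_zero [MeasurableSpace X] [OpensMeasurableSpace X]
    [R1Space X] {μ : Measure X} [IsFiniteMeasureOnCompacts μ] (hf : ContinuousOn f U)
    (hU : IsOpen U) (hK : IsCompact K) (hKc : IsClosed K) (hKU : K ⊆ U)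
    (h0 : ∀ x, x ∉ K → f x = 0) : Integrable f μ :=
  (hf.continuous_of_eq_zero hU hKc hKU h0).integrable_of_hasCompactSupport
    (HasCompactSupport.intro hK h0)

end CompactSupport

theorem hasDerivAt_max_zero_sq (t : ℝ) :
    HasDerivAt (fun s : ℝ => (max s 0) ^ 2) (2 * max t 0) t := by
  rcases lt_trichotomy t 0 with ht | rfl | ht
  · rw [max_eq_right ht.le, mul_zero]
    refine (hasDerivAt_const t (0 : ℝ)).congr_of_eventuallyEq ?_
    filter_upwards [gt_mem_nhds ht] with s hs
    simp [max_eq_right hs.le]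
  · rw [max_self, mul_zero, hasDerivAt_iff_isLittleO_nhds_zero]
    have h : (fun s : ℝ => s ^ 2) =o[nhds 0] fun s => s := by
      simpa using Asymptotics.isLittleO_pow_pow (𝕜 := ℝ) one_lt_two
    refine Asymptotics.IsBigO.trans_isLittleO (Asymptotics.IsBigO.of_bound 1 ?_) h
    refine Eventually.of_forall fun s => ?_
    simp only [zero_add, max_self, smul_zero, sub_zero, norm_pow, one_mul, Real.norm_eq_abs,
      ne_eq, OfNat.ofNat_ne_zero, not_false_eq_true, zero_pow]
    rcases le_total s 0 with h | h
    · simp [max_eq_right h, sq_nonneg]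
    · simp [max_eq_left h]
  · rw [max_eq_left ht.le]
    have : HasDerivAt (fun s : ℝ => s ^ 2) (2 * t) t := by simpa using hasDerivAt_pow 2 t
    refine this.congr_of_eventuallyEq ?_
    filter_upwards [lt_mem_nhds ht] with s hs
    rw [max_eq_left hs.le]

theorem contDiff_max_zero_sq : ContDiff ℝ 1 fun s : ℝ => (max s 0) ^ 2 := by
  rw [contDiff_one_iff_deriv]
  refine ⟨fun t => (hasDerivAt_max_zero_sq t).differentiableAt, ?_⟩
  rw [funext fun t => (hasDerivAt_max_zero_sq t).deriv]
  fun_prop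

abbrev Plane : Type := EuclideanSpace ℝ (Fin 2)

namespace PHarmonicOn

variable {p : ℝ} {U : Set Plane} {u u₁ u₂ : Plane → ℝ}

theorem continuousOn_pFlux (hp : 1 < p) (hU : IsOpen U) (hu : PHarmonicOn p U u) :
    ContinuousOn (fun x => pFlux p (gradient u x)) U :=
  (continuous_pFlux hp).comp_continuousOn (hu.1.continuousOn_gradient hU)

theorem integral_eq_zero (hu : PHarmonicOn p U u) {η : Plane → ℝ} (hη : ContDiff ℝ 1 η)
    (hc : HasCompactSupport η) (hs : tsupport η ⊆ U) :
    ∫ x, ⟪pFlux p (gradient u x), gradient η x⟫ = 0 := by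
  rw [← hu.2 η hη hc hs, setIntegral_eq_integral_of_forall_compl_eq_zero]
  · simp only [pFlux, real_inner_smul_left]
  · intro x hx
    rw [gradient_of_notMem_tsupport fun h => hx (hs h), inner_zero_right, mul_zero]

theorem integrable_inner (hp : 1 < p) (hU : IsOpen U) (hu : PHarmonicOn p U u)
    {g : Plane → Plane} {K : Set Plane} (hg : ContinuousOn g U) (hK : IsCompact K) (hKU : K ⊆ U)
    (h0 : ∀ x, x ∉ K → g x = 0) : Integrable fun x => ⟪pFlux p (gradient u x), g x⟫ :=
  ((hu.continuousOn_pFlux hp hU).inner hg).integrable_of_eq_zero hU hK hK.isClosed hKU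
    fun x hx => by rw [h0 x hx, inner_zero_right]

theorem integral_sub_eq_zero (hp : 1 < p) (hU : IsOpen U) (h₁ : PHarmonicOn p U u₁)
    (h₂ : PHarmonicOn p U u₂) {η : Plane → ℝ} (hη : ContDiff ℝ 1 η)
    (hc : HasCompactSupport η) (hs : tsupport η ⊆ U) :
    ∫ x, ⟪pFlux p (gradient u₁ x) - pFlux p (gradient u₂ x), gradient η x⟫ = 0 := by
  simp only [inner_sub_left]
  have hg := hη.continuous_gradient.continuousOn (s := U)
  rw [integral_sub (h₁.integrable_inner hp hU hg hc hs fun x => gradient_of_notMem_tsupport)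
    (h₂.integrable_inner hp hU hg hc hs fun x => gradient_of_notMem_tsupport),
    h₁.integral_eq_zero hη hc hs, h₂.integral_eq_zero hη hc hs, sub_zero]

theorem mono {U' : Set Plane} (hu : PHarmonicOn p U u) (h : U' ⊆ U) : PHarmonicOn p U' u := by
  refine ⟨hu.1.mono h, fun η hη hc hs => ?_⟩
  rw [← hu.integral_eq_zero hη hc (hs.trans h), setIntegral_eq_integral_of_forall_compl_eq_zero]
  · simp only [pFlux, real_inner_smul_left]
  · intro x hx
    rw [gradient_of_notMem_tsupport fun h => hx (hs h), inner_zero_right, mul_zero]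

/-- The comparison principle: the difference of two `p`-harmonic functions attains its maximum on
the boundary. -/
theorem sub_le_of_boundary (hp : 1 < p) (hU : IsOpen U) (h₁ : PHarmonicOn p U u₁)
    (h₂ : PHarmonicOn p U u₂) {D K : Set Plane} (hD : IsOpen D) (hK : IsCompact K) (hDK : D ⊆ K)
    (hKU : K ⊆ U) {m : ℝ} (hm : ∀ x ∈ K \ D, u₁ x - u₂ x ≤ m) {x₀ : Plane} (hx₀ : x₀ ∈ D) :
    u₁ x₀ - u₂ x₀ ≤ m := by
  by_contra! hlt
  set w : Plane → ℝ := fun x => u₁ x - u₂ x with hw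
  obtain ⟨s, hms, hsx⟩ := exists_between hlt
  have hwc : ContDiffOn ℝ 1 w U := h₁.1.sub h₂.1
  set η : Plane → ℝ := D.indicator fun x => (max (w x - s) 0) ^ 2 with hη
  set S : Set Plane := {x ∈ K | s ≤ w x}
  have hSc : IsClosed S := by
    have := (hwc.continuousOn.mono hKU).preimage_isClosed_of_isClosed hK.isClosed
      (isClosed_Ici (a := s))
    exact this
  have hSK : S ⊆ K := fun x hx => hx.1
  have hSD : S ⊆ D := fun x hx => by
    by_contra hxD
    exact absurd (hm x ⟨hx.1, hxD⟩) (not_le.2 (hms.trans_le hx.2))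
  have hηS : ∀ x, x ∉ S → η x = 0 := by
    intro x hx
    by_cases hxD : x ∈ D
    · rw [hη, indicator_of_mem hxD, max_eq_right, zero_pow two_ne_zero]
      by_contra! h
      exact hx ⟨hDK hxD, by linarith⟩
    · exact indicator_of_notMem hxD _
  have hts : tsupport η ⊆ S :=
    closure_minimal (fun x hx => by_contra fun h => hx (hηS x h)) hSc
  have hηc : HasCompactSupport η := hK.of_isClosed_subset (isClosed_tsupport _) (hts.trans hSK)
  have hloc : ∀ x ∈ D, η =ᶠ[nhds x] fun y => (max (w y - s) 0) ^ 2 := fun x hx => by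
    filter_upwards [hD.mem_nhds hx] with y hy using indicator_of_mem hy _
  have hηd : ContDiff ℝ 1 η := by
    refine contDiff_iff_contDiffAt.2 fun x => ?_
    by_cases hx : x ∈ tsupport η
    swap
    · exact contDiffAt_const.congr_of_eventuallyEq (notMem_tsupport_iff_eventuallyEq.1 hx)
    have hxD := hSD (hts hx)
    refine ContDiffAt.congr_of_eventuallyEq ?_ (hloc x hxD)
    exact contDiff_max_zero_sq.contDiffAt.comp x
      ((hwc.contDiffAt (hU.mem_nhds (hKU (hDK hxD)))).sub contDiffAt_const)
  have hgrad : ∀ x ∈ D, gradient η x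
      = (2 * max (w x - s) 0) • (gradient u₁ x - gradient u₂ x) := by
    intro x hx
    have hxU := hKU (hDK hx)
    have hwx : HasGradientAt (fun y => w y - s) (gradient u₁ x - gradient u₂ x) x := by
      simpa using ((h₁.1.hasGradientAt hU hxU).fun_sub' (h₂.1.hasGradientAt hU hxU)).fun_sub'
        (hasGradientAt_const x s)
    rw [(hloc x hx).gradient_eq]
    exact (HasDerivAt.comp_hasGradientAt (f := fun y => w y - s)
      (hasDerivAt_max_zero_sq (w x - s)) hwx).gradient
  have hgrad0 : ∀ x, x ∉ S → gradient η x = 0 :=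
    fun x hx => gradient_of_notMem_tsupport fun h => hx (hts h)
  have hSU : S ⊆ U := hSK.trans hKU
  have hint := h₁.integral_sub_eq_zero hp hU h₂ hηd hηc (hts.trans hSU)
  have hcont : Continuous fun x =>
      ⟪pFlux p (gradient u₁ x) - pFlux p (gradient u₂ x), gradient η x⟫ :=
    (((h₁.continuousOn_pFlux hp hU).sub (h₂.continuousOn_pFlux hp hU)).inner
      hηd.continuous_gradient.continuousOn).continuous_of_eq_zero hU hSc hSU
      fun x hx => by rw [hgrad0 x hx, inner_zero_right]
  have hnn : ∀ x, 0 ≤ ⟪pFlux p (gradient u₁ x) - pFlux p (gradient u₂ x), gradient η x⟫ := by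
    intro x
    by_cases hx : x ∈ S
    · rw [hgrad x (hSD hx), real_inner_smul_right]
      exact mul_nonneg (by positivity) (inner_pFlux_sub_nonneg hp _ _).1
    · rw [hgrad0 x hx, inner_zero_right]
  have hzero : ∀ x, gradient η x = 0 := by
    intro x
    by_cases hx : x ∈ S
    swap
    · exact hgrad0 x hx
    have h0 : ⟪pFlux p (gradient u₁ x) - pFlux p (gradient u₂ x), gradient η x⟫ = 0 := by
      by_contra hne
      refine absurd hint (ne_of_gt ?_)
      exact hcont.integral_pos_of_hasCompactSupport_nonneg_nonzero
        (HasCompactSupport.intro (hK.of_isClosed_subset hSc hSK)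
          fun y hy => by rw [hgrad0 y hy, inner_zero_right]) hnn hne
    rw [hgrad x (hSD hx), real_inner_smul_right] at h0
    rw [hgrad x (hSD hx)]
    rcases mul_eq_zero.1 h0 with h | h
    · rw [h, zero_smul]
    · rw [(inner_pFlux_sub_nonneg hp _ _).2 h, sub_self, smul_zero]
  obtain ⟨y, hy⟩ := (ne_univ_iff_exists_notMem S).1 (hK.of_isClosed_subset hSc hSK).ne_univ
  have hconst : η x₀ = η y := by
    refine is_const_of_fderiv_eq_zero (𝕜 := ℝ) (hηd.differentiable one_ne_zero) (fun x => ?_) _ _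
    rw [← toDual_gradient, hzero, map_zero]
  rw [hηS y hy, hη, indicator_of_mem hx₀, sq_eq_zero_iff,
    max_eq_left (sub_nonneg.2 hsx.le), sub_eq_zero] at hconst
  exact hsx.ne' hconst

/-- Invariance of `p`-harmonicity under dilations and translations. -/
theorem comp_affine (hu : PHarmonicOn p U u) (a : Plane) {s c : ℝ} (hs : 0 < s) (hc : 0 ≤ c) :
    PHarmonicOn p ((fun y => a + s • y) ⁻¹' U) fun y => c * u (a + s • y) := by
  have hg : ∀ y, gradient (fun y => c * u (a + s • y)) y = (c * s) • gradient u (a + s • y) := by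
    intro y
    rw [gradient_const_mul c (fun y => u (a + s • y)), gradient_comp_affine, smul_smul]
  have hA : ContDiff ℝ 1 fun y : Plane => a + s • y := by fun_prop
  have hB : ContDiff ℝ 1 fun x : Plane => s⁻¹ • (x - a) := by fun_prop
  refine ⟨contDiffOn_const.mul (hu.1.comp hA.contDiffOn fun y hy => hy), fun η hη hηc hηs => ?_⟩
  set ζ : Plane → ℝ := fun x => η (s⁻¹ • (x - a)) with hζ
  have hζη : ∀ y, ζ (a + s • y) = η y := fun y => by
    simp [hζ, smul_smul, inv_mul_cancel₀ hs.ne']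
  have hζd : ContDiff ℝ 1 ζ := hη.comp hB
  have himg : IsCompact ((fun y => a + s • y) '' tsupport η) :=
    hηc.isCompact.image hA.continuous
  have h0 : ∀ x, x ∉ (fun y => a + s • y) '' tsupport η → ζ x = 0 := by
    intro x hx
    by_contra hne
    refine hx ⟨s⁻¹ • (x - a), subset_tsupport _ hne, ?_⟩
    simp [smul_smul, mul_inv_cancel₀ hs.ne']
  have hζs : tsupport ζ ⊆ U :=
    (closure_minimal (fun x (hx : ζ x ≠ 0) => by_contra fun h => hx (h0 x h))
      himg.isClosed).trans (image_subset_iff.2 hηs)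
  have hζc : HasCompactSupport ζ := HasCompactSupport.intro himg h0
  have hgη : ∀ y, gradient η y = s • gradient ζ (a + s • y) := by
    intro y
    rw [← gradient_comp_affine ζ a y s, funext hζη]
  have hI := hu.integral_eq_zero hζd hζc hζs
  set k : Plane → ℝ := fun x => ⟪pFlux p (gradient u x), gradient ζ x⟫
  rw [setIntegral_eq_integral_of_forall_compl_eq_zero]
  · have e : ∀ y, ‖gradient (fun y => c * u (a + s • y)) y‖ ^ (p - 2) *
        ⟪gradient (fun y => c * u (a + s • y)) y, gradient η y⟫
        = ((c * s) ^ (p - 2) * (c * s) * s) * k (a + s • y) := by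
      intro y
      rw [← real_inner_smul_left, ← pFlux, hg, hgη, pFlux_smul (by positivity),
        real_inner_smul_left, real_inner_smul_right]
      ring
    simp only [e]
    rw [integral_const_mul, Measure.integral_comp_smul volume (fun y => k (a + y)) s,
      integral_add_left_eq_self, hI, smul_zero, mul_zero]
  · intro x hx
    rw [gradient_of_notMem_tsupport fun h => hx (hηs h), inner_zero_right, mul_zero]

end PHarmonicOn

theorem HasGradientAt.hasDerivAt_line {V : Type*} [NormedAddCommGroup V] [InnerProductSpace ℝ V]
    [CompleteSpace V] {f : V → ℝ} {f' x e : V} {t : ℝ} (hf : HasGradientAt f f' (x + t • e)) :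
    HasDerivAt (fun s : ℝ => f (x + s • e)) ⟪f', e⟫ t := by
  have h1 : HasDerivAt (fun s : ℝ => x + s • e) e t := by
    simpa using ((hasDerivAt_id t).smul_const e).const_add x
  exact hf.hasFDerivAt.comp_hasDerivAt t h1

theorem gradient_comp_add_right {V : Type*} [NormedAddCommGroup V] [InnerProductSpace ℝ V]
    [CompleteSpace V] (f : V → ℝ) (v x : V) :
    gradient (fun y => f (y + v)) x = gradient f (x + v) := by
  rw [gradient, fderiv_comp_add_right]
  rfl

namespace PHarmonicOn

variable {p : ℝ} {U : Set Plane} {u : Plane → ℝ}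

theorem comp_add_right (hu : PHarmonicOn p U u) (v : Plane) :
    PHarmonicOn p ((fun y => y + v) ⁻¹' U) fun y => u (y + v) := by
  simpa [add_comm v] using hu.comp_affine v one_pos zero_le_one

/-- The maximum principle for directional derivatives. -/
theorem inner_gradient_le_of_boundary (hp : 1 < p) (hU : IsOpen U) (hu : PHarmonicOn p U u)
    {D K : Set Plane} (hD : IsOpen D) (hK : IsCompact K) (hDK : D ⊆ K) (hKU : K ⊆ U)
    {e : Plane} {c : ℝ} (hc : ∀ y ∈ K \ D, ⟪gradient u y, e⟫ ≤ c) {x : Plane} (hx : x ∈ D) :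
    ⟪gradient u x, e⟫ ≤ c := by
  refine le_of_forall_pos_le_add fun κ hκ => ?_
  have hW : IsOpen (U ∩ (fun y => ⟪gradient u y, e⟫) ⁻¹' Iio (c + κ)) :=
    ((hu.1.continuousOn_gradient hU).inner continuousOn_const).isOpen_inter_preimage hU isOpen_Iio
  obtain ⟨r₁, hr₁, h₁⟩ := (hK.diff hD).exists_cthickening_subset_open hW
    fun y hy => ⟨hKU hy.1, (hc y hy).trans_lt (by linarith)⟩
  obtain ⟨r₂, hr₂, h₂⟩ := hK.exists_cthickening_subset_open hU hKU
  have hsmall : ∀ᶠ t : ℝ in nhdsWithin 0 (Ioi 0), 0 < t ∧ t * ‖e‖ < r₁ ∧ t * ‖e‖ < r₂ := by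
    have hlim : Tendsto (fun t : ℝ => t * ‖e‖) (nhdsWithin 0 (Ioi 0)) (nhds 0) := by
      have : Continuous fun t : ℝ => t * ‖e‖ := by fun_prop
      simpa using (this.tendsto 0).mono_left nhdsWithin_le_nhds
    filter_upwards [self_mem_nhdsWithin, hlim.eventually (gt_mem_nhds hr₁),
      hlim.eventually (gt_mem_nhds hr₂)] with t h0 h1 h2 using ⟨h0, h1, h2⟩
  have hquot : ∀ᶠ t : ℝ in nhdsWithin 0 (Ioi 0), t⁻¹ * (u (x + t • e) - u x) ≤ c + κ := by
    filter_upwards [hsmall] with t ⟨ht, ht₁, ht₂⟩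
    have hU' : IsOpen (U ∩ (fun y => y + t • e) ⁻¹' U) :=
      hU.inter (hU.preimage (by fun_prop))
    have hKU' : K ⊆ U ∩ (fun y => y + t • e) ⁻¹' U := fun y hy => by
      refine ⟨hKU hy, h₂ (Metric.mem_cthickening_of_dist_le _ y _ _ hy ?_)⟩
      rw [dist_eq_norm, add_sub_cancel_left, norm_smul, Real.norm_of_nonneg ht.le]
      exact ht₂.le
    have hcmp := ((hu.comp_add_right (t • e)).mono inter_subset_right).sub_le_of_boundary hp hU'
      (hu.mono inter_subset_left) hD hK hDK hKU' (m := t * (c + κ)) ?_ hx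
    · rwa [inv_mul_le_iff₀ ht]
    · intro y hy
      have hseg : ∀ s ∈ Icc 0 t,
          y + s • e ∈ U ∩ (fun y => ⟪gradient u y, e⟫) ⁻¹' Iio (c + κ) := fun s hs => by
        refine h₁ (Metric.mem_cthickening_of_dist_le _ y _ _ hy ?_)
        rw [dist_eq_norm, add_sub_cancel_left, norm_smul, Real.norm_of_nonneg hs.1]
        exact (mul_le_mul_of_nonneg_right hs.2 (norm_nonneg e)).trans ht₁.le
      have hder : ∀ s ∈ Icc 0 t,
          HasDerivAt (fun s : ℝ => u (y + s • e)) ⟪gradient u (y + s • e), e⟫ s := fun s hs =>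
        (hu.1.hasGradientAt hU (hseg s hs).1).hasDerivAt_line
      have := (convex_Icc 0 t).image_sub_le_mul_sub_of_deriv_le
        (fun s hs => (hder s hs).continuousAt.continuousWithinAt)
        (fun s hs => (hder s (interior_subset hs)).differentiableAt.differentiableWithinAt)
        (C := c + κ) (fun s hs => by
          rw [(hder s (interior_subset hs)).deriv]; exact (hseg s (interior_subset hs)).2.le)
        0 (left_mem_Icc.2 ht.le) t (right_mem_Icc.2 ht.le) ht.le
      simpa [mul_comm] using this
  have hd : HasDerivAt (fun s : ℝ => u (x + s • e)) ⟪gradient u x, e⟫ 0 := by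
    have h := hu.1.hasGradientAt hU (hKU (hDK hx))
    rw [show x = x + (0 : ℝ) • e by simp] at h
    simpa using h.hasDerivAt_line
  refine le_of_tendsto (hd.tendsto_slope_zero_right) ?_
  simpa using hquot

/-- The maximum principle for the gradient. -/
theorem norm_gradient_sub_le_of_boundary (hp : 1 < p) (hU : IsOpen U) (hu : PHarmonicOn p U u)
    {D K : Set Plane} (hD : IsOpen D) (hK : IsCompact K) (hDK : D ⊆ K) (hKU : K ⊆ U)
    {b : Plane} {ε : ℝ} (hε : ∀ y ∈ K \ D, ‖gradient u y - b‖ ≤ ε) {x : Plane} (hx : x ∈ D)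
    (hε0 : 0 ≤ ε) : ‖gradient u x - b‖ ≤ ε := by
  set e := gradient u x - b with he
  have h : ⟪gradient u x, e⟫ ≤ ⟪b, e⟫ + ε * ‖e‖ := by
    refine hu.inner_gradient_le_of_boundary hp hU hD hK hDK hKU (fun y hy => ?_) hx
    rw [← sub_le_iff_le_add', ← inner_sub_left]
    exact (real_inner_le_norm _ _).trans (mul_le_mul_of_nonneg_right (hε y hy) (norm_nonneg _))
  rw [← sub_le_iff_le_add', ← inner_sub_left, ← he, real_inner_self_eq_norm_sq] at h
  nlinarith [norm_nonneg e]

end PHarmonicOn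

theorem integral_norm_translate_sub_le {V F : Type*} [NormedAddCommGroup V] [NormedSpace ℝ V]
    [MeasurableSpace V] [BorelSpace V] [FiniteDimensional ℝ V] {μ : Measure V}
    [μ.IsAddHaarMeasure] [NormedAddCommGroup F] [NormedSpace ℝ F] [CompleteSpace F]
    {g : V → F} (hg : ContDiff ℝ 1 g) (hc : HasCompactSupport g) (v : V) :
    ∫ x, ‖g (x + v) - g x‖ ∂μ ≤ ∫ x, ‖fderiv ℝ g x v‖ ∂μ := by
  have hk : Continuous fun x => ‖fderiv ℝ g x v‖ :=
    ((hg.continuous_fderiv one_ne_zero).clm_apply continuous_const).norm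
  have hkc : HasCompactSupport fun x => ‖fderiv ℝ g x v‖ :=
    (hc.fderiv_apply (𝕜 := ℝ) v).norm
  have hkey : ∀ x, ‖g (x + v) - g x‖ ≤ ∫ t in (0 : ℝ)..1, ‖fderiv ℝ g (x + t • v) v‖ := by
    intro x
    have hd : ∀ t ∈ uIcc (0 : ℝ) 1,
        HasDerivAt (fun t : ℝ => g (x + t • v)) (fderiv ℝ g (x + t • v) v) t := by
      intro t _
      have h1 : HasDerivAt (fun s : ℝ => x + s • v) v t := by
        simpa using ((hasDerivAt_id t).smul_const v).const_add x
      exact (hg.differentiable one_ne_zero _).hasFDerivAt.comp_hasDerivAt t h1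
    have hcont : Continuous fun t : ℝ => fderiv ℝ g (x + t • v) v :=
      ((hg.continuous_fderiv one_ne_zero).comp (by fun_prop)).clm_apply continuous_const
    have := intervalIntegral.integral_eq_sub_of_hasDerivAt hd (hcont.intervalIntegrable _ _)
    simp only [one_smul, zero_smul, add_zero] at this
    rw [← this]
    exact intervalIntegral.norm_integral_le_integral_norm zero_le_one
  set k : V → ℝ := fun x => ‖fderiv ℝ g x v‖
  have hprod : Integrable (fun z : V × ℝ => k (z.1 + z.2 • v))
      (μ.prod (volume.restrict (Ioc (0 : ℝ) 1))) := by
    rw [integrable_prod_iff' (by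
      exact (hk.comp
        (by fun_prop : Continuous fun z : V × ℝ => z.1 + z.2 • v)).aestronglyMeasurable)]
    refine ⟨Eventually.of_forall fun t => ?_, ?_⟩
    · exact (hk.integrable_of_hasCompactSupport hkc).comp_add_right (t • v)
    · have : ∀ t : ℝ, ∫ x, ‖k (x + t • v)‖ ∂μ = ∫ x, ‖k x‖ ∂μ := fun t =>
        integral_add_right_eq_self (fun x => ‖k x‖) (t • v)
      simp only [this]
      exact integrable_const _
  calc ∫ x, ‖g (x + v) - g x‖ ∂μ
      ≤ ∫ x, (∫ t in (0 : ℝ)..1, k (x + t • v)) ∂μ := by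
        refine integral_mono_of_nonneg (Eventually.of_forall fun x => norm_nonneg _) ?_
          (Eventually.of_forall hkey)
        simp only [intervalIntegral.integral_of_le zero_le_one]
        exact hprod.integral_prod_left
    _ = ∫ t in (0 : ℝ)..1, (∫ x, k (x + t • v) ∂μ) := by
        simp only [intervalIntegral.integral_of_le zero_le_one]
        exact integral_integral_swap (f := fun x t => k (x + t • v)) hprod
    _ = ∫ x, k x ∂μ := by
        have : ∀ t : ℝ, ∫ x, k (x + t • v) ∂μ = ∫ x, k x ∂μ := fun t =>
          integral_add_right_eq_self k (t • v)
        simp [this]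

theorem ContDiffOn.contDiff_of_eq_zero {V F : Type*} [NormedAddCommGroup V] [NormedSpace ℝ V]
    [NormedAddCommGroup F] [NormedSpace ℝ F] {n : WithTop ℕ∞} {f : V → F} {U K : Set V}
    (hf : ContDiffOn ℝ n f U) (hU : IsOpen U) (hK : IsClosed K) (hKU : K ⊆ U)
    (h0 : ∀ x, x ∉ K → f x = 0) : ContDiff ℝ n f := by
  refine contDiff_iff_contDiffAt.2 fun x => ?_
  by_cases hx : x ∈ K
  · exact hf.contDiffAt (hU.mem_nhds (hKU hx))
  · refine (contDiffAt_const (c := (0 : F))).congr_of_eventuallyEq ?_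
    filter_upwards [hK.isOpen_compl.mem_nhds hx] with y hy using h0 y hy

theorem pFlux_two {V : Type*} [NormedAddCommGroup V] [InnerProductSpace ℝ V] (a : V) :
    pFlux 2 a = a := by
  simp [pFlux]

theorem norm_gradient_eq {V : Type*} [NormedAddCommGroup V] [InnerProductSpace ℝ V]
    [CompleteSpace V] (f : V → ℝ) (x : V) : ‖gradient f x‖ = ‖fderiv ℝ f x‖ := by
  rw [gradient, LinearIsometryEquiv.norm_map]

theorem ContDiffOn.norm_sub_le_of_norm_gradient_le {V : Type*} [NormedAddCommGroup V]
    [InnerProductSpace ℝ V] [CompleteSpace V] {f : V → ℝ} {U S : Set V} {C : ℝ}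
    (hf : ContDiffOn ℝ 1 f U) (hU : IsOpen U) (hS : Convex ℝ S) (hSU : S ⊆ U)
    (hC : ∀ x ∈ S, ‖gradient f x‖ ≤ C) {x y : V} (hx : x ∈ S) (hy : y ∈ S) :
    ‖f y - f x‖ ≤ C * ‖y - x‖ :=
  hS.norm_image_sub_le_of_norm_fderiv_le
    (fun _ hz => (hf.hasGradientAt hU (hSU hz)).differentiableAt)
    (fun _ hz => (norm_gradient_eq f _).symm.trans_le (hC _ hz)) hx hy

namespace PHarmonicOn

variable {p : ℝ} {U : Set Plane} {u : Plane → ℝ}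

theorem integral_flux_difference (hp : 1 < p) (hU : IsOpen U) (hu : PHarmonicOn p U u)
    {K : Set Plane} (hK : IsCompact K) {v : Plane} (hKU : K ⊆ U ∩ (fun y => y + v) ⁻¹' U)
    {χ : Plane → ℝ} (hχ : ContDiff ℝ 1 χ) (hχ0 : ∀ x, x ∉ K → χ x = 0) :
    ∫ x, ⟪pFlux p (gradient u (x + v)) - pFlux p (gradient u x),
      χ x ^ 2 • (gradient u (x + v) - gradient u x)
        + (2 * χ x * (u (x + v) - u x)) • gradient χ x⟫ = 0 := by
  have hU' : IsOpen (U ∩ (fun y => y + v) ⁻¹' U) := hU.inter (hU.preimage (by fun_prop))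
  have h₁ := (hu.comp_add_right v).mono (inter_subset_right (s := U))
  have h₂ := hu.mono (inter_subset_left (t := (fun y => y + v) ⁻¹' U))
  set η : Plane → ℝ := fun x => χ x ^ 2 * (u (x + v) - u x) with hη
  have hη0 : ∀ x, x ∉ K → η x = 0 := fun x hx => by simp [hη, hχ0 x hx]
  have hηd : ContDiff ℝ 1 η :=
    ((hχ.pow 2).contDiffOn.mul (h₁.1.sub h₂.1)).contDiff_of_eq_zero hU' hK.isClosed hKU hη0
  have hts : tsupport η ⊆ K :=
    closure_minimal (fun x (hx : η x ≠ 0) => by_contra fun h => hx (hη0 x h)) hK.isClosed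
  have key := h₁.integral_sub_eq_zero hp hU' h₂ hηd (HasCompactSupport.intro hK hη0)
    (hts.trans hKU)
  rw [← key]
  refine integral_congr_ae (Eventually.of_forall fun x => ?_)
  simp only [gradient_comp_add_right]
  by_cases hx : x ∈ K
  · have hsq := (HasDerivAt.comp_hasGradientAt (hasDerivAt_pow 2 (χ x)) (hχ.hasGradientAt x))
    have hw := (h₁.1.hasGradientAt hU' (hKU hx)).fun_sub' (h₂.1.hasGradientAt hU' (hKU hx))
    rw [(hsq.fun_mul' hw).gradient, gradient_comp_add_right]
    simp only [smul_smul]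
    congr 3
    norm_num
    ring
  · have h1 : x ∉ tsupport χ := fun h => hx <|
      closure_minimal (fun x (hx : χ x ≠ 0) => by_contra fun h => hx (hχ0 x h)) hK.isClosed h
    rw [gradient_of_notMem_tsupport fun h => hx (hts h), gradient_of_notMem_tsupport h1, hχ0 x hx]
    simp

theorem energy_estimate_of_two_le (hp : 2 ≤ p) (hU : IsOpen U) (hu : PHarmonicOn p U u)
    {K : Set Plane} (hK : IsCompact K) {v : Plane} (hKU : K ⊆ U ∩ (fun y => y + v) ⁻¹' U)
    {χ : Plane → ℝ} (hχ : ContDiff ℝ 1 χ) (hχ0 : ∀ x, x ∉ K → χ x = 0)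
    (hw : ∀ x ∈ K, |u (x + v) - u x| ≤ ‖v‖) (hg₁ : ∀ x ∈ K, ‖gradient u x‖ ≤ 1)
    (hg₂ : ∀ x ∈ K, ‖gradient u (x + v)‖ ≤ 1) :
    ∫ x, χ x ^ 2 * ‖pFlux p (gradient u (x + v)) - pFlux p (gradient u x)‖ ^ 2
      ≤ (4 * (p - 1) ^ 2 * ∫ x, ‖gradient χ x‖ ^ 2) * ‖v‖ ^ 2 := by
  have hp1 : 1 < p := by linarith
  have hU' : IsOpen (U ∩ (fun y => y + v) ⁻¹' U) := hU.inter (hU.preimage (by fun_prop))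
  have hgc₂ : ContinuousOn (fun x => gradient u x) (U ∩ (fun y => y + v) ⁻¹' U) :=
    (hu.1.continuousOn_gradient hU).mono inter_subset_left
  have hgc₁ : ContinuousOn (fun x => gradient u (x + v)) (U ∩ (fun y => y + v) ⁻¹' U) :=
    (hu.1.continuousOn_gradient hU).comp (by fun_prop) inter_subset_right
  have huc₂ : ContinuousOn u (U ∩ (fun y => y + v) ⁻¹' U) :=
    hu.1.continuousOn.mono inter_subset_left
  have huc₁ : ContinuousOn (fun x => u (x + v)) (U ∩ (fun y => y + v) ⁻¹' U) :=
    hu.1.continuousOn.comp (by fun_prop) inter_subset_right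
  have hB : ContinuousOn (fun x => pFlux p (gradient u (x + v)) - pFlux p (gradient u x))
      (U ∩ (fun y => y + v) ⁻¹' U) :=
    ((continuous_pFlux hp1).comp_continuousOn hgc₁).sub
      ((continuous_pFlux hp1).comp_continuousOn hgc₂)
  have hχ0' : ∀ x, x ∉ K → gradient χ x = 0 := fun x hx =>
    gradient_of_notMem_tsupport fun h => hx <|
      closure_minimal (fun x (hx : χ x ≠ 0) => by_contra fun h => hx (hχ0 x h)) hK.isClosed h
  have hχc := hχ.continuous.continuousOn (s := U ∩ (fun y => y + v) ⁻¹' U)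
  have hχgc := hχ.continuous_gradient.continuousOn (s := U ∩ (fun y => y + v) ⁻¹' U)
  have hid := hu.integral_flux_difference hp1 hU hK hKU hχ hχ0
  set B : Plane → Plane := fun x => pFlux p (gradient u (x + v)) - pFlux p (gradient u x)
  set T : Plane → ℝ := fun x => ⟪B x, χ x ^ 2 • (gradient u (x + v) - gradient u x)
        + (2 * χ x * (u (x + v) - u x)) • gradient χ x⟫
  have hT : Integrable T := by
    refine ContinuousOn.integrable_of_eq_zero (hB.inner ?_) hU' hK hK.isClosed hKU
      fun x hx => by simp [T, hχ0 x hx]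
    exact ((hχc.pow 2).smul (hgc₁.sub hgc₂)).add
      (((continuousOn_const.mul hχc).mul (huc₁.sub huc₂)).smul hχgc)
  have hX : Integrable fun x => χ x ^ 2 * ‖B x‖ ^ 2 :=
    ((hχc.pow 2).mul (hB.norm.pow 2)).integrable_of_eq_zero hU' hK hK.isClosed hKU
      fun x hx => by simp [hχ0 x hx]
  have hY : Integrable fun x => ‖gradient χ x‖ ^ 2 :=
    (hχgc.norm.pow 2).integrable_of_eq_zero hU' hK hK.isClosed hKU
      fun x hx => by simp [hχ0' x hx]
  have hpt : ∀ x, 2⁻¹ * (χ x ^ 2 * ‖B x‖ ^ 2)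
      ≤ (p - 1) * T x + 2 * (p - 1) ^ 2 * ‖v‖ ^ 2 * ‖gradient χ x‖ ^ 2 := by
    intro x
    by_cases hx : x ∈ K
    · have h1 : ‖B x‖ ^ 2 ≤ (p - 1) * ⟪B x, gradient u (x + v) - gradient u x⟫ :=
        norm_pFlux_sub_sq_le hp (hg₂ x hx) (hg₁ x hx)
      have h2 : |(u (x + v) - u x) * ⟪B x, gradient χ x⟫| ≤ ‖v‖ * (‖B x‖ * ‖gradient χ x‖) := by
        rw [abs_mul]
        exact mul_le_mul (hw x hx) (abs_real_inner_le_norm _ _) (abs_nonneg _) (norm_nonneg _)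
      have h3 : T x = χ x ^ 2 * ⟪B x, gradient u (x + v) - gradient u x⟫
          + 2 * χ x * ((u (x + v) - u x) * ⟪B x, gradient χ x⟫) := by
        simp only [T, inner_add_right, real_inner_smul_right]
        ring
      have h4 : χ x ^ 2 * ‖B x‖ ^ 2
          ≤ (p - 1) * (χ x ^ 2 * ⟪B x, gradient u (x + v) - gradient u x⟫) := by
        nlinarith [mul_le_mul_of_nonneg_left h1 (sq_nonneg (χ x))]
      have h5 : |χ x * ((u (x + v) - u x) * ⟪B x, gradient χ x⟫)|
          ≤ |χ x| * (‖v‖ * (‖B x‖ * ‖gradient χ x‖)) := by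
        rw [abs_mul]
        exact mul_le_mul_of_nonneg_left h2 (abs_nonneg _)
      have h6 := mul_le_mul_of_nonneg_left ((abs_le.1 h5).1) (by linarith : 0 ≤ 2 * (p - 1))
      rw [h3]
      nlinarith [sq_nonneg (|χ x| * ‖B x‖ - 2 * (p - 1) * ‖v‖ * ‖gradient χ x‖), sq_abs (χ x)]
    · simp [T, hχ0 x hx, hχ0' x hx]
  have := integral_mono (hX.const_mul _) ((hT.const_mul (p - 1)).add (hY.const_mul _)) hpt
  simp only [Pi.add_apply] at this
  rw [integral_const_mul, integral_add (hT.const_mul _) (hY.const_mul _), integral_const_mul,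
    integral_const_mul, hid] at this
  linarith

theorem energy_estimate_of_le_two (hp : 1 < p) (hp2 : p ≤ 2) (hU : IsOpen U)
    (hu : PHarmonicOn p U u) {K K' : Set Plane} (hK : IsCompact K) (hK' : IsCompact K')
    {v : Plane} (hKK : K ⊆ K') (hKK' : ∀ x ∈ K, x + v ∈ K') (hKU : K' ⊆ U)
    {χ : Plane → ℝ} (hχ : ContDiff ℝ 2 χ) (hχ0 : ∀ x, x ∉ K → χ x = 0)
    (hw : ∀ x ∈ K, |u (x + v) - u x| ≤ ‖v‖) (hg : ∀ x ∈ K', ‖gradient u x‖ ≤ 1) :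
    ∫ x, χ x ^ 2 * ‖gradient u (x + v) - gradient u x‖ ^ 2
      ≤ (2 / (p - 1) * (2 * (∫ x, ‖fderiv ℝ (fun y => χ y • gradient χ y) x‖)
        + 2 / (p - 1) * ∫ x, ‖gradient χ x‖ ^ 2)) * ‖v‖ ^ 2 := by
  have hU' : IsOpen (U ∩ (fun y => y + v) ⁻¹' U) := hU.inter (hU.preimage (by fun_prop))
  have hKU' : K ⊆ U ∩ (fun y => y + v) ⁻¹' U := fun x hx =>
    ⟨hKU (hKK hx), hKU (hKK' x hx)⟩
  have hχ1 : ContDiff ℝ 1 χ := hχ.of_le one_le_two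
  have hgc₂ : ContinuousOn (fun x => gradient u x) (U ∩ (fun y => y + v) ⁻¹' U) :=
    (hu.1.continuousOn_gradient hU).mono inter_subset_left
  have hgc₁ : ContinuousOn (fun x => gradient u (x + v)) (U ∩ (fun y => y + v) ⁻¹' U) :=
    (hu.1.continuousOn_gradient hU).comp (by fun_prop) inter_subset_right
  have hB : ContinuousOn (fun x => pFlux p (gradient u (x + v)) - pFlux p (gradient u x))
      (U ∩ (fun y => y + v) ⁻¹' U) :=
    ((continuous_pFlux hp).comp_continuousOn hgc₁).sub
      ((continuous_pFlux hp).comp_continuousOn hgc₂)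
  have hχ0' : ∀ x, x ∉ K → gradient χ x = 0 := fun x hx =>
    gradient_of_notMem_tsupport fun h => hx <|
      closure_minimal (fun x (hx : χ x ≠ 0) => by_contra fun h => hx (hχ0 x h)) hK.isClosed h
  have hχc := hχ.continuous.continuousOn (s := U ∩ (fun y => y + v) ⁻¹' U)
  have hχgc := hχ1.continuous_gradient.continuousOn (s := U ∩ (fun y => y + v) ⁻¹' U)
  have hid := hu.integral_flux_difference hp hU hK hKU' hχ1 hχ0
  set w : Plane → ℝ := fun x => u (x + v) - u x with hwdef
  have hwd : ContDiffOn ℝ 1 w (U ∩ (fun y => y + v) ⁻¹' U) :=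
    ((hu.comp_add_right v).1.mono inter_subset_right).sub (hu.1.mono inter_subset_left)
  have hwg : ∀ x ∈ K, HasGradientAt w (gradient u (x + v) - gradient u x) x := fun x hx => by
    have h := ((hu.comp_add_right v).1.hasGradientAt (hU.preimage (by fun_prop))
      (hKU' hx).2).fun_sub' (hu.1.hasGradientAt hU (hKU' hx).1)
    rwa [gradient_comp_add_right] at h
  set m : Plane → Plane := fun y => χ y • gradient χ y with hm
  have hmd : ContDiff ℝ 1 m := by
    refine hχ1.smul ((InnerProductSpace.toDual ℝ Plane).symm.toContinuousLinearEquiv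
      |>.contDiff.comp (hχ.fderiv_right (m := 1) (by norm_num)))
  have hm0 : ∀ x, x ∉ K → m x = 0 := fun x hx => by simp [hm, hχ0 x hx]
  set g : Plane → Plane := fun x => (2 * w x) • m x with hgdef
  have hg0 : ∀ x, x ∉ K → g x = 0 := fun x hx => by simp [hgdef, hm0 x hx]
  have hgd : ContDiff ℝ 1 g :=
    ((contDiffOn_const.mul hwd).smul hmd.contDiffOn).contDiff_of_eq_zero hU' hK.isClosed hKU' hg0
  have hgs : HasCompactSupport g := HasCompactSupport.intro hK hg0
  set A : Plane → Plane := fun x => pFlux p (gradient u x)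
  have hA : ContinuousOn A U := hu.continuousOn_pFlux hp hU
  -- summation by parts moves the difference from the flux to the cut-off term
  have hIA : Integrable fun x => ⟪A x, g x⟫ :=
    (hA.inner hgd.continuous.continuousOn).integrable_of_eq_zero hU hK hK.isClosed
      (hKK.trans hKU) fun x hx => by rw [hg0 x hx, inner_zero_right]
  have hgK' : ∀ x, x ∉ K' → g (x + -v) = 0 := fun x hx => hg0 _ fun h => hx <| by
    simpa using hKK' _ h
  have hIA' : Integrable fun x => ⟪A x, g (x + -v)⟫ := by
    refine ContinuousOn.integrable_of_eq_zero (hA.inner ?_) hU hK' hK'.isClosed hKU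
      fun x hx => by rw [hgK' x hx, inner_zero_right]
    exact (hgd.continuous.comp (by fun_prop)).continuousOn
  have hshift : ∫ x, ⟪A (x + v), g x⟫ = ∫ x, ⟪A x, g (x + -v)⟫ := by
    rw [← integral_add_right_eq_self (fun x => ⟪A x, g (x + -v)⟫) v]
    simp
  have hIAv : Integrable fun x => ⟪A (x + v), g x⟫ := by
    simpa using hIA'.comp_add_right v
  have hparts : -∫ x, ⟪A (x + v) - A x, g x⟫ ≤ ∫ x, ‖fderiv ℝ g x v‖ := by
    have e : -∫ x, ⟪A (x + v) - A x, g x⟫ = ∫ x, ⟪A x, g x - g (x + -v)⟫ := by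
      simp only [inner_sub_left, inner_sub_right]
      rw [integral_sub hIAv hIA, integral_sub hIA hIA', hshift]
      ring
    rw [e]
    have hL := integral_norm_translate_sub_le (μ := volume) hgd hgs (-v)
    simp only [map_neg, norm_neg] at hL
    refine le_trans (integral_mono ?_ ?_ fun x => ?_) hL
    · simp only [inner_sub_right]
      exact hIA.sub hIA'
    · have hgi := hgd.continuous.integrable_of_hasCompactSupport (μ := volume) hgs
      exact ((hgi.comp_add_right (-v)).sub hgi).norm
    · by_cases hx : x ∈ K'
      · calc ⟪A x, g x - g (x + -v)⟫ ≤ ‖A x‖ * ‖g x - g (x + -v)‖ := real_inner_le_norm _ _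
          _ ≤ 1 * ‖g x - g (x + -v)‖ :=
            mul_le_mul_of_nonneg_right (norm_pFlux_le_one hp (hg x hx)) (norm_nonneg _)
          _ = ‖g (x + -v) - g x‖ := by rw [one_mul, norm_sub_rev]
      · rw [hgK' x hx, hg0 x fun h => hx (hKK h)]
        simp
  set W : Plane → Plane := fun x => gradient u (x + v) - gradient u x
  have hW : ContinuousOn W (U ∩ (fun y => y + v) ⁻¹' U) := hgc₁.sub hgc₂
  have hX : Integrable fun x => χ x ^ 2 * ‖W x‖ ^ 2 :=
    ((hχc.pow 2).mul (hW.norm.pow 2)).integrable_of_eq_zero hU' hK hK.isClosed hKU'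
      fun x hx => by simp [hχ0 x hx]
  have hY : Integrable fun x => ‖gradient χ x‖ ^ 2 :=
    (hχgc.norm.pow 2).integrable_of_eq_zero hU' hK hK.isClosed hKU'
      fun x hx => by simp [hχ0' x hx]
  have hms : HasCompactSupport m := HasCompactSupport.intro hK hm0
  have hZ : Integrable fun x => ‖fderiv ℝ m x‖ :=
    ((hmd.continuous_fderiv one_ne_zero).integrable_of_hasCompactSupport (hms.fderiv ℝ)).norm
  have hDg : ∀ x, ‖fderiv ℝ g x v‖ ≤ 2 * ‖v‖ ^ 2 * ‖fderiv ℝ m x‖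
      + ((p - 1) / 2 * (χ x ^ 2 * ‖W x‖ ^ 2) + 2 / (p - 1) * ‖v‖ ^ 2 * ‖gradient χ x‖ ^ 2) := by
    intro x
    have hp0 : 0 < p - 1 := by linarith
    by_cases hx : x ∈ K
    · have hd : HasFDerivAt g ((2 * w x) • fderiv ℝ m x
          + ((2 : ℝ) • InnerProductSpace.toDual ℝ Plane (W x)).smulRight (m x)) x :=
        ((hwg x hx).hasFDerivAt.const_mul 2).smul
          (hmd.differentiable one_ne_zero x).hasFDerivAt
      have e : fderiv ℝ g x v = (2 * w x) • fderiv ℝ m x v + (2 * ⟪W x, v⟫) • m x := by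
        rw [hd.fderiv]; rfl
      have hwx : |w x| ≤ ‖v‖ := hw x hx
      have h1 : ‖(2 * w x) • fderiv ℝ m x v‖ ≤ 2 * ‖v‖ ^ 2 * ‖fderiv ℝ m x‖ := by
        rw [norm_smul, Real.norm_eq_abs, abs_mul, abs_two]
        calc 2 * |w x| * ‖fderiv ℝ m x v‖ ≤ 2 * ‖v‖ * (‖fderiv ℝ m x‖ * ‖v‖) :=
              mul_le_mul (by linarith) ((fderiv ℝ m x).le_opNorm v) (norm_nonneg _) (by positivity)
          _ = _ := by ring
      have h2 : ‖(2 * ⟪W x, v⟫) • m x‖ ≤ 2 * (‖W x‖ * ‖v‖) * (|χ x| * ‖gradient χ x‖) := by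
        rw [norm_smul, Real.norm_eq_abs, abs_mul, abs_two, hm, norm_smul, Real.norm_eq_abs]
        gcongr
        exact abs_real_inner_le_norm _ _
      have h3 : 2 * (‖W x‖ * ‖v‖) * (|χ x| * ‖gradient χ x‖)
          ≤ (p - 1) / 2 * (χ x ^ 2 * ‖W x‖ ^ 2)
            + 2 / (p - 1) * ‖v‖ ^ 2 * ‖gradient χ x‖ ^ 2 := by
        have h4 : 0 ≤ ((p - 1) * (|χ x| * ‖W x‖) - 2 * (‖v‖ * ‖gradient χ x‖)) ^ 2
            / (2 * (p - 1)) := by positivity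
        have h5 : ((p - 1) * (|χ x| * ‖W x‖) - 2 * (‖v‖ * ‖gradient χ x‖)) ^ 2 / (2 * (p - 1))
            = (p - 1) / 2 * (|χ x| ^ 2 * ‖W x‖ ^ 2) + 2 / (p - 1) * ‖v‖ ^ 2 * ‖gradient χ x‖ ^ 2
              - 2 * (‖W x‖ * ‖v‖) * (|χ x| * ‖gradient χ x‖) := by
          field_simp
          ring
        rw [h5, sq_abs] at h4
        linarith
      rw [e]
      exact (norm_add_le _ _).trans (add_le_add h1 (h2.trans h3))
    · have : fderiv ℝ g x = 0 := fderiv_of_notMem_tsupport ℝ fun h => hx <|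
        closure_minimal (fun x (hx : g x ≠ 0) => by_contra fun h => hx (hg0 x h)) hK.isClosed h
      rw [this]
      simp only [_root_.zero_apply, norm_zero]
      positivity
  have hDgi : Integrable fun x => ‖fderiv ℝ g x v‖ :=
    ((((hgd.continuous_fderiv one_ne_zero).clm_apply continuous_const)
      ).integrable_of_hasCompactSupport (hgs.fderiv_apply (𝕜 := ℝ) v)).norm
  have hXY : Integrable fun x => (p - 1) / 2 * (χ x ^ 2 * ‖W x‖ ^ 2)
      + 2 / (p - 1) * ‖v‖ ^ 2 * ‖gradient χ x‖ ^ 2 := (hX.const_mul _).add (hY.const_mul _)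
  have hbound := integral_mono hDgi ((hZ.const_mul _).add hXY) hDg
  simp only [Pi.add_apply] at hbound
  rw [integral_add (hZ.const_mul _) hXY, integral_add (hX.const_mul _) (hY.const_mul _),
    integral_const_mul, integral_const_mul, integral_const_mul] at hbound
  have hTi : Integrable fun x => ⟪A (x + v) - A x, χ x ^ 2 • W x⟫ :=
    (hB.inner ((hχc.pow 2).smul hW)).integrable_of_eq_zero hU' hK hK.isClosed hKU'
      fun x hx => by simp [hχ0 x hx]
  have hBgi : Integrable fun x => ⟪A (x + v) - A x, g x⟫ := by
    simp only [inner_sub_left]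
    exact hIAv.sub hIA
  have hTe : ∫ x, ⟪A (x + v) - A x, χ x ^ 2 • W x⟫ = -∫ x, ⟪A (x + v) - A x, g x⟫ := by
    rw [eq_neg_iff_add_eq_zero, ← integral_add hTi hBgi, ← hid]
    refine integral_congr_ae (Eventually.of_forall fun x => ?_)
    simp only [← inner_add_right, hgdef, hm, smul_smul]
    congr 3
    ring
  have hmono : (p - 1) * ∫ x, χ x ^ 2 * ‖W x‖ ^ 2
      ≤ ∫ x, ⟪A (x + v) - A x, χ x ^ 2 • W x⟫ := by
    rw [← integral_const_mul]
    refine integral_mono (hX.const_mul _) hTi fun x => ?_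
    by_cases hx : x ∈ K
    · have h := inner_pFlux_sub hp hp2 (hg _ (hKK' x hx)) (hg x (hKK hx))
      simp only [real_inner_smul_right]
      nlinarith [mul_le_mul_of_nonneg_left h (sq_nonneg (χ x))]
    · simp [hχ0 x hx]
  have hp0 : 0 < p - 1 := by linarith
  have hfin : (p - 1) / 2 * ∫ x, χ x ^ 2 * ‖W x‖ ^ 2 ≤
      (2 * (∫ x, ‖fderiv ℝ m x‖) + 2 / (p - 1) * ∫ x, ‖gradient χ x‖ ^ 2) * ‖v‖ ^ 2 := by
    linarith
  calc ∫ x, χ x ^ 2 * ‖W x‖ ^ 2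
      = 2 / (p - 1) * ((p - 1) / 2 * ∫ x, χ x ^ 2 * ‖W x‖ ^ 2) := by field_simp
    _ ≤ 2 / (p - 1) * ((2 * (∫ x, ‖fderiv ℝ m x‖) + 2 / (p - 1) * ∫ x, ‖gradient χ x‖ ^ 2)
          * ‖v‖ ^ 2) := mul_le_mul_of_nonneg_left hfin (by positivity)
    _ = _ := by ring

/-- Uniform bound for the difference quotients of a suitable flux of a `p`-harmonic function with
bounded gradient. -/
theorem exists_energy_estimate (hp : 1 < p) :
    ∃ r : ℝ, 1 < r ∧ ∃ C : ℝ, ∀ (U : Set Plane) (u : Plane → ℝ), IsOpen U → PHarmonicOn p U u →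
      Metric.closedBall 0 4 ⊆ U → (∀ x ∈ Metric.closedBall (0 : Plane) 4, ‖gradient u x‖ ≤ 1) →
      ∀ v : Plane, ‖v‖ ≤ 1 →
        ∫ x in Metric.closedBall (0 : Plane) 2,
          ‖pFlux r (gradient u (x + v)) - pFlux r (gradient u x)‖ ^ 2 ≤ C * ‖v‖ ^ 2 := by
  let χ : ContDiffBump (0 : Plane) := ⟨2, 3, by norm_num, by norm_num⟩
  have hχ : ContDiff ℝ 2 χ := χ.contDiff
  have hχ0 : ∀ x, x ∉ Metric.closedBall (0 : Plane) 3 → χ x = 0 := fun x hx => by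
    by_contra h
    exact hx (χ.tsupport_eq ▸ subset_tsupport _ h)
  have hadd : ∀ v : Plane, ‖v‖ ≤ 1 → ∀ x ∈ Metric.closedBall (0 : Plane) 3,
      x + v ∈ Metric.closedBall (0 : Plane) 4 := fun v hv x hx => by
    rw [mem_closedBall_zero_iff] at hx ⊢
    linarith [norm_add_le x v]
  have h34 : Metric.closedBall (0 : Plane) 3 ⊆ Metric.closedBall 0 4 :=
    Metric.closedBall_subset_closedBall (by norm_num)
  have hK : IsCompact (Metric.closedBall (0 : Plane) 3) := isCompact_closedBall _ _
  -- the bump function equals one on the smaller ball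
  have hcut : ∀ (U : Set Plane) (u : Plane → ℝ) (r : ℝ) (v : Plane), 1 < r → IsOpen U →
      ContDiffOn ℝ 1 u U → Metric.closedBall 0 4 ⊆ U → ‖v‖ ≤ 1 →
      ∫ x in Metric.closedBall (0 : Plane) 2,
          ‖pFlux r (gradient u (x + v)) - pFlux r (gradient u x)‖ ^ 2
        ≤ ∫ x, χ x ^ 2 * ‖pFlux r (gradient u (x + v)) - pFlux r (gradient u x)‖ ^ 2 := by
    intro U u r v hr hU hu h4 hv
    have hU' : IsOpen (U ∩ (fun y => y + v) ⁻¹' U) := hU.inter (hU.preimage (by fun_prop))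
    have hgc : ContinuousOn (fun x => χ x ^ 2 *
        ‖pFlux r (gradient u (x + v)) - pFlux r (gradient u x)‖ ^ 2)
        (U ∩ (fun y => y + v) ⁻¹' U) := by
      refine (χ.continuous.continuousOn.pow 2).mul (ContinuousOn.pow (ContinuousOn.norm
        (ContinuousOn.sub ?_ ?_)) 2)
      · exact (continuous_pFlux hr).comp_continuousOn
          ((hu.continuousOn_gradient hU).comp (by fun_prop) inter_subset_right)
      · exact (continuous_pFlux hr).comp_continuousOn
          ((hu.continuousOn_gradient hU).mono inter_subset_left)
    have hI := hgc.integrable_of_eq_zero (μ := volume) hU' hK hK.isClosed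
      (fun x hx => ⟨h4 (h34 hx), h4 (hadd v hv x hx)⟩) fun x hx => by simp [hχ0 x hx]
    refine le_trans (le_of_eq ?_) (setIntegral_le_integral (s := Metric.closedBall 0 2) hI
      (Eventually.of_forall fun x => by positivity))
    refine setIntegral_congr_fun Metric.isClosed_closedBall.measurableSet fun x hx => ?_
    rw [χ.one_of_mem_closedBall hx, one_pow, one_mul]
  have hwv : ∀ (U : Set Plane) (u : Plane → ℝ) (v : Plane), IsOpen U →
      ContDiffOn ℝ 1 u U → Metric.closedBall 0 4 ⊆ U →
      (∀ x ∈ Metric.closedBall (0 : Plane) 4, ‖gradient u x‖ ≤ 1) → ‖v‖ ≤ 1 →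
      ∀ x ∈ Metric.closedBall (0 : Plane) 3, |u (x + v) - u x| ≤ ‖v‖ := by
    intro U u v hU hu h4 hg hv x hx
    simpa using hu.norm_sub_le_of_norm_gradient_le hU (convex_closedBall 0 4) h4 hg (h34 hx)
      (hadd v hv x hx)
  rcases le_total 2 p with h2 | h2
  · refine ⟨p, hp, 4 * (p - 1) ^ 2 * ∫ x, ‖gradient χ x‖ ^ 2, fun U u hU hu h4 hg v hv =>
      (hcut U u p v hp hU hu.1 h4 hv).trans ?_⟩
    exact hu.energy_estimate_of_two_le h2 hU hK
      (fun x hx => ⟨h4 (h34 hx), h4 (hadd v hv x hx)⟩) (hχ.of_le one_le_two) hχ0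
      (hwv U u v hU hu.1 h4 hg hv) (fun x hx => hg x (h34 hx)) fun x hx => hg _ (hadd v hv x hx)
  · refine ⟨2, one_lt_two, 2 / (p - 1) * (2 * (∫ x, ‖fderiv ℝ (fun y => χ y • gradient χ y) x‖)
        + 2 / (p - 1) * ∫ x, ‖gradient χ x‖ ^ 2), fun U u hU hu h4 hg v hv =>
      (hcut U u 2 v one_lt_two hU hu.1 h4 hv).trans ?_⟩
    simp only [pFlux_two]
    exact hu.energy_estimate_of_le_two hp h2 hU hK (isCompact_closedBall 0 4) h34 (hadd v hv) h4
      hχ hχ0 (hwv U u v hU hu.1 h4 hg hv) hg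

end PHarmonicOn

theorem norm_sub_le_of_integral_translate_sq_le {V : Type*} [NormedAddCommGroup V]
    [NormedSpace ℝ V] [CompleteSpace V] {g : ℝ → V} (hg : Continuous g) {h ω ρ κ : ℝ} (hh : 0 < h)
    (hρ : 0 < ρ) (hκ : 0 < κ)
    (hω : ∀ s ∈ Icc (-ρ) ρ, ∀ t ∈ Icc 0 h, ‖g (s + t) - g s‖ ≤ ω)
    (hS : ∫ s in (-ρ)..ρ, ‖g (s + h) - g s‖ ^ 2 ≤ κ ^ 2 * h ^ 2 / ρ) {y z : ℝ}
    (hy : y ∈ Icc (-ρ) ρ) (hz : z ∈ Icc (-ρ) ρ) : ‖g z - g y‖ ≤ 2 * ω + 2 * κ := by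
  wlog hyz : y ≤ z generalizing y z
  · rw [norm_sub_rev]
    exact this hz hy (le_of_not_ge hyz)
  have hint : ∀ a b : ℝ, IntervalIntegrable g volume a b := fun a b => hg.intervalIntegrable a b
  -- averages over intervals of length `h`
  have hav : ∀ s ∈ Icc (-ρ) ρ, ‖(∫ t in s..(s + h), g t) - h • g s‖ ≤ ω * h := by
    intro s hs
    have h1 : (∫ t in s..(s + h), g t) - h • g s = ∫ t in s..(s + h), (g t - g s) := by
      rw [intervalIntegral.integral_sub (hint _ _) intervalIntegrable_const]
      simp
    rw [h1]
    have := intervalIntegral.norm_integral_le_of_norm_le_const (a := s) (b := s + h)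
      (f := fun t => g t - g s) (C := ω) (fun t ht => by
        rw [uIoc_of_le (by linarith)] at ht
        simpa using hω s hs (t - s) ⟨by linarith [ht.1], by linarith [ht.2]⟩)
    simpa [abs_of_pos hh] using this
  have hid : (∫ t in z..(z + h), g t) - (∫ t in y..(y + h), g t)
      = ∫ s in y..z, (g (s + h) - g s) := by
    rw [intervalIntegral.integral_sub (Continuous.intervalIntegrable (by fun_prop) _ _) (hint _ _),
      intervalIntegral.integral_comp_add_right (f := g)]
    have e1 := intervalIntegral.integral_add_adjacent_intervals (hint y z) (hint z (z + h))
    have e2 := intervalIntegral.integral_add_adjacent_intervals (hint y (y + h))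
      (hint (y + h) (z + h))
    have e3 := e1.trans e2.symm
    rw [sub_eq_sub_iff_add_eq_add, add_comm, e3, add_comm]
  have hcd : Continuous fun s => g (s + h) - g s := by fun_prop
  have hbd : ‖∫ s in y..z, (g (s + h) - g s)‖ ≤ 3 / 2 * κ * h := by
    calc ‖∫ s in y..z, (g (s + h) - g s)‖ ≤ ∫ s in y..z, ‖g (s + h) - g s‖ :=
          intervalIntegral.norm_integral_le_integral_norm hyz
      _ ≤ ∫ s in (-ρ)..ρ, ‖g (s + h) - g s‖ :=
          intervalIntegral.integral_mono_interval hy.1 hyz hz.2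
            (Eventually.of_forall fun _ => norm_nonneg _) (hcd.norm.intervalIntegrable _ _)
      _ ≤ ∫ s in (-ρ)..ρ, (κ * h / (2 * ρ) + ρ / (2 * κ * h) * ‖g (s + h) - g s‖ ^ 2) := by
          refine intervalIntegral.integral_mono_on (by linarith) (hcd.norm.intervalIntegrable _ _)
            (Continuous.intervalIntegrable (by fun_prop) _ _) fun s _ => ?_
          set a := ‖g (s + h) - g s‖
          have : κ * h / (2 * ρ) + ρ / (2 * κ * h) * a ^ 2 - a
              = (κ * h - ρ * a) ^ 2 / (2 * ρ * κ * h) := by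
            field_simp
            ring
          have h2 : 0 ≤ (κ * h - ρ * a) ^ 2 / (2 * ρ * κ * h) := by positivity
          linarith
      _ = κ * h + ρ / (2 * κ * h) * ∫ s in (-ρ)..ρ, ‖g (s + h) - g s‖ ^ 2 := by
          rw [intervalIntegral.integral_add intervalIntegrable_const
            (Continuous.intervalIntegrable (by fun_prop) _ _),
            intervalIntegral.integral_const_mul, intervalIntegral.integral_const, smul_eq_mul]
          congr 1
          field_simp
          ring
      _ ≤ κ * h + ρ / (2 * κ * h) * (κ ^ 2 * h ^ 2 / ρ) := by gcongr
      _ = 3 / 2 * κ * h := by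
          field_simp
          ring
  have hfin : h * ‖g z - g y‖ ≤ h * (2 * ω + 3 / 2 * κ) := by
    have : h • (g z - g y) = ((∫ t in y..(y + h), g t) - h • g y)
        - ((∫ t in z..(z + h), g t) - h • g z) + ∫ s in y..z, (g (s + h) - g s) := by
      rw [← hid, smul_sub]
      abel
    calc h * ‖g z - g y‖ = ‖h • (g z - g y)‖ := by rw [norm_smul, Real.norm_of_nonneg hh.le]
      _ ≤ ω * h + ω * h + 3 / 2 * κ * h := by
          rw [this]
          exact (norm_add_le _ _).trans (add_le_add ((norm_sub_le _ _).trans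
            (add_le_add (hav y hy) (hav z hz))) hbd)
      _ = _ := by ring
  linarith [le_of_mul_le_mul_left hfin hh]

theorem exists_le_div_of_integral_lt {S : ℝ → ℝ} (hS : Continuous S) {δ c : ℝ} (hδ : 0 < δ)
    (hδ1 : δ ≤ 1) (hI : ∫ ρ in δ..1, S ρ < c * -Real.log δ) : ∃ ρ ∈ Icc δ 1, S ρ ≤ c / ρ := by
  by_contra! hcon
  have h0 : (0 : ℝ) ∉ uIcc δ 1 := by
    rw [uIcc_of_le hδ1]
    exact fun h => absurd h.1 (not_le.2 hδ)
  have h1 : ∫ ρ in δ..1, c / ρ ≤ ∫ ρ in δ..1, S ρ := by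
    refine intervalIntegral.integral_mono_on hδ1 ?_ (hS.intervalIntegrable _ _)
      fun ρ hρ => (hcon ρ hρ).le
    refine ContinuousOn.intervalIntegrable (continuousOn_const.div continuousOn_id fun x hx h => ?_)
    exact h0 ((show x = 0 from h) ▸ hx)
  have h2 : ∫ ρ in δ..1, c / ρ = c * -Real.log δ := by
    simp_rw [div_eq_mul_inv]
    rw [intervalIntegral.integral_const_mul, integral_inv h0, one_div, Real.log_inv]
  linarith

theorem integral_add_neg_le {T : ℝ → ℝ} (hT : Continuous T) (hT0 : ∀ s, 0 ≤ T s) {δ : ℝ}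
    (hδ : 0 ≤ δ) : ∫ ρ in δ..1, (T ρ + T (-ρ)) ≤ ∫ s in (-1)..1, T s := by
  have hi : ∀ a b : ℝ, IntervalIntegrable T volume a b := fun a b => hT.intervalIntegrable a b
  rw [intervalIntegral.integral_add (hi _ _)
    (Continuous.intervalIntegrable (by fun_prop) _ _), intervalIntegral.integral_comp_neg]
  rw [← intervalIntegral.integral_add_adjacent_intervals (hi (-1) (-δ)) (hi (-δ) 1),
    ← intervalIntegral.integral_add_adjacent_intervals (hi (-δ) δ) (hi δ 1)]
  have := intervalIntegral.integral_nonneg (μ := volume) (show -δ ≤ δ by linarith)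
    (fun s _ => hT0 s)
  linarith

/-- **Courant–Lebesgue lemma** on squares: a continuous map whose difference quotients have
bounded energy has small oscillation on the boundary of some square of controlled size. -/
theorem exists_square_boundary_oscillation_le (V : Type*) [NormedAddCommGroup V]
    [NormedSpace ℝ V] [CompleteSpace V] {C κ : ℝ} (hC : 0 ≤ C) (hκ : 0 < κ) :
    ∃ δ, 0 < δ ∧ δ ≤ 1 ∧ ∀ F : ℝ → ℝ → V, Continuous (Function.uncurry F) →
      (∀ h, 0 < h → h ≤ 1 →
        ∫ s in (-1)..1, ∫ t in (-1)..1, ‖F s (t + h) - F s t‖ ^ 2 ≤ C * h ^ 2) →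
      (∀ h, 0 < h → h ≤ 1 →
        ∫ t in (-1)..1, ∫ s in (-1)..1, ‖F (s + h) t - F s t‖ ^ 2 ≤ C * h ^ 2) →
      ∃ ρ, δ ≤ ρ ∧ ρ ≤ 1 ∧ ∀ s ∈ Icc (-ρ) ρ, ∀ t ∈ Icc (-ρ) ρ,
        (s = ρ ∨ s = -ρ ∨ t = ρ ∨ t = -ρ) → ‖F s t - F ρ ρ‖ ≤ 8 * κ := by
  refine ⟨Real.exp (-((2 * C + 1) / κ ^ 2)), Real.exp_pos _, ?_, ?_⟩
  · rw [Real.exp_le_one_iff, neg_nonpos]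
    positivity
  intro F hF h1 h2
  set δ := Real.exp (-((2 * C + 1) / κ ^ 2))
  have hδ0 : 0 < δ := Real.exp_pos _
  have hδ1 : δ ≤ 1 := by
    rw [Real.exp_le_one_iff, neg_nonpos]
    positivity
  obtain ⟨h, hh0, hh1, hω⟩ : ∃ h, 0 < h ∧ h ≤ 1 ∧ ∀ s ∈ Icc (-1 : ℝ) 1, ∀ t ∈ Icc (-1 : ℝ) 1,
      ∀ τ ∈ Icc 0 h, ‖F (s + τ) t - F s t‖ ≤ κ ∧ ‖F s (t + τ) - F s t‖ ≤ κ := by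
    have huc := (isCompact_Icc.prod isCompact_Icc).uniformContinuousOn_of_continuous
      (s := Icc (-2 : ℝ) 2 ×ˢ Icc (-2 : ℝ) 2) hF.continuousOn
    obtain ⟨d, hd, hd'⟩ := Metric.uniformContinuousOn_iff.1 huc κ hκ
    refine ⟨min 1 (d / 2), by positivity, min_le_left _ _, fun s hs t ht τ hτ => ?_⟩
    have hτ1 : τ ≤ 1 := hτ.2.trans (min_le_left _ _)
    have hτd : τ < d := by linarith [hτ.2.trans (min_le_right _ _)]
    have m0 : (s, t) ∈ Icc (-2 : ℝ) 2 ×ˢ Icc (-2 : ℝ) 2 :=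
      ⟨⟨by linarith [hs.1], by linarith [hs.2]⟩, ⟨by linarith [ht.1], by linarith [ht.2]⟩⟩
    have m1 : (s + τ, t) ∈ Icc (-2 : ℝ) 2 ×ˢ Icc (-2 : ℝ) 2 :=
      ⟨⟨by linarith [hs.1, hτ.1], by linarith [hs.2]⟩, m0.2⟩
    have m2 : (s, t + τ) ∈ Icc (-2 : ℝ) 2 ×ˢ Icc (-2 : ℝ) 2 :=
      ⟨m0.1, ⟨by linarith [ht.1, hτ.1], by linarith [ht.2]⟩⟩
    constructor
    · have := hd' _ m1 _ m0 (by simpa [Prod.dist_eq, abs_of_nonneg hτ.1] using ⟨hτd, hd⟩)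
      rw [dist_eq_norm] at this
      exact this.le
    · have := hd' _ m2 _ m0 (by simpa [Prod.dist_eq, abs_of_nonneg hτ.1] using ⟨hd, hτd⟩)
      rw [dist_eq_norm] at this
      exact this.le
  have hFs : ∀ s, Continuous (F s) := fun s => hF.comp (Continuous.prodMk_right s)
  have hFt : ∀ t, Continuous fun s => F s t := fun t => hF.comp (Continuous.prodMk_left t)
  have hF2 : ∀ {α : Type} [TopologicalSpace α] {f g : α → ℝ}, Continuous f → Continuous g →
      Continuous fun x => F (f x) (g x) := fun hf hg => hF.comp (hf.prodMk hg)
  set T : ℝ → ℝ := fun s => ∫ t in (-1)..1, ‖F s (t + h) - F s t‖ ^ 2 with hTdef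
  set B : ℝ → ℝ := fun t => ∫ s in (-1)..1, ‖F (s + h) t - F s t‖ ^ 2 with hBdef
  have hTc : Continuous T := intervalIntegral.continuous_parametric_intervalIntegral_of_continuous'
    (by
      have := hF2 (continuous_fst (X := ℝ) (Y := ℝ)) (continuous_snd.add_const h)
      exact (this.sub hF).norm.pow 2) _ _
  have hBc : Continuous B := intervalIntegral.continuous_parametric_intervalIntegral_of_continuous'
    (by
      have e1 := hF2 ((continuous_snd (X := ℝ) (Y := ℝ)).add_const h) continuous_fst
      have e2 := hF2 (continuous_snd (X := ℝ) (Y := ℝ)) continuous_fst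
      exact (e1.sub e2).norm.pow 2) _ _
  have hT0 : ∀ s, 0 ≤ T s := fun s => intervalIntegral.integral_nonneg (by norm_num)
    fun _ _ => by positivity
  have hB0 : ∀ s, 0 ≤ B s := fun s => intervalIntegral.integral_nonneg (by norm_num)
    fun _ _ => by positivity
  obtain ⟨ρ, hρ, hS⟩ := exists_le_div_of_integral_lt (S := fun ρ => (T ρ + T (-ρ)) + (B ρ + B (-ρ)))
    (by fun_prop) (c := κ ^ 2 * h ^ 2) hδ0 hδ1 (by
      rw [intervalIntegral.integral_add (Continuous.intervalIntegrable (by fun_prop) _ _)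
        (Continuous.intervalIntegrable (by fun_prop) _ _)]
      have a1 := (integral_add_neg_le hTc hT0 hδ0.le).trans (h1 h hh0 hh1)
      have a2 := (integral_add_neg_le hBc hB0 hδ0.le).trans (h2 h hh0 hh1)
      have a3 : κ ^ 2 * h ^ 2 * -Real.log δ = (2 * C + 1) * h ^ 2 := by
        rw [Real.log_exp]
        field_simp
      have a4 : 0 < h ^ 2 := by positivity
      rw [a3]
      linarith)
  have hρ0 : 0 < ρ := hδ0.trans_le hρ.1
  have hsub : ∀ {s}, s ∈ Icc (-ρ) ρ → s ∈ Icc (-1 : ℝ) 1 := fun hs =>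
    ⟨by linarith [hs.1, hρ.2], hs.2.trans hρ.2⟩
  have hmono : ∀ f : ℝ → ℝ, Continuous f → (∀ x, 0 ≤ f x) →
      ∫ s in (-ρ)..ρ, f s ≤ ∫ s in (-1)..1, f s := fun f hf hf0 =>
    intervalIntegral.integral_mono_interval (by linarith [hρ.2]) (by linarith) hρ.2
      (Eventually.of_forall hf0) (hf.intervalIntegrable _ _)
  have hmρ : ρ ∈ Icc (-ρ) ρ := ⟨by linarith, le_rfl⟩
  have hmρ' : -ρ ∈ Icc (-ρ) ρ := ⟨le_rfl, by linarith⟩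
  have hvert : ∀ s ∈ Icc (-ρ) ρ, T s ≤ κ ^ 2 * h ^ 2 / ρ → ∀ t ∈ Icc (-ρ) ρ,
      ‖F s t - F s ρ‖ ≤ 4 * κ := by
    intro s hs hTs t ht
    have := norm_sub_le_of_integral_translate_sq_le (hFs s) hh0 hρ0 hκ
      (fun t ht τ hτ => (hω s (hsub hs) t (hsub ht) τ hτ).2)
      ((hmono _ ((((hFs s).comp (continuous_add_const h)).sub (hFs s)).norm.pow 2)
        fun _ => sq_nonneg _).trans hTs) hmρ ht
    linarith
  have hhor : ∀ t ∈ Icc (-ρ) ρ, B t ≤ κ ^ 2 * h ^ 2 / ρ → ∀ s ∈ Icc (-ρ) ρ,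
      ‖F s t - F ρ t‖ ≤ 4 * κ := by
    intro t ht hBt s hs
    have := norm_sub_le_of_integral_translate_sq_le (hFt t) hh0 hρ0 hκ
      (fun s hs τ hτ => (hω s (hsub hs) t (hsub ht) τ hτ).1)
      ((hmono _ ((((hFt t).comp (continuous_add_const h)).sub (hFt t)).norm.pow 2)
        fun _ => sq_nonneg _).trans hBt) hmρ hs
    linarith
  have t1 : T ρ ≤ κ ^ 2 * h ^ 2 / ρ := by linarith [hT0 ρ, hT0 (-ρ), hB0 ρ, hB0 (-ρ)]
  have t2 : T (-ρ) ≤ κ ^ 2 * h ^ 2 / ρ := by linarith [hT0 ρ, hT0 (-ρ), hB0 ρ, hB0 (-ρ)]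
  have b1 : B ρ ≤ κ ^ 2 * h ^ 2 / ρ := by linarith [hT0 ρ, hT0 (-ρ), hB0 ρ, hB0 (-ρ)]
  have b2 : B (-ρ) ≤ κ ^ 2 * h ^ 2 / ρ := by linarith [hT0 ρ, hT0 (-ρ), hB0 ρ, hB0 (-ρ)]
  refine ⟨ρ, hρ.1, hρ.2, fun s hs t ht hst => ?_⟩
  rcases hst with rfl | rfl | rfl | rfl
  · linarith [hvert _ hmρ t1 t ht]
  · linarith [hvert _ hmρ' t2 t ht, hhor _ hmρ b1 _ hmρ',
      norm_sub_le_norm_sub_add_norm_sub (F (-ρ) t) (F (-ρ) ρ) (F ρ ρ)]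
  · linarith [hhor _ hmρ b1 s hs]
  · linarith [hhor _ hmρ' b2 s hs, hvert _ hmρ t1 _ hmρ',
      norm_sub_le_norm_sub_add_norm_sub (F s (-ρ)) (F ρ (-ρ)) (F ρ ρ)]

theorem intervalIntegral_le_setIntegral_closedBall {f : Plane → ℝ} (hf : Continuous f)
    (hf0 : ∀ x, 0 ≤ f x) :
    ∫ s in (-1)..1, ∫ t in (-1)..1, f !₂[s, t] ≤ ∫ x in Metric.closedBall (0 : Plane) 2, f x := by
  let Φ : ℝ × ℝ → Plane := fun z => !₂[z.1, z.2]
  have hΦ : MeasurePreserving Φ :=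
    (PiLp.volume_preserving_toLp (Fin 2)).comp (volume_preserving_finTwoArrow ℝ).symm
  have hΦe : MeasurableEmbedding Φ :=
    (MeasurableEquiv.toLp 2 (Fin 2 → ℝ)).measurableEmbedding.comp
      MeasurableEquiv.finTwoArrow.symm.measurableEmbedding
  have hΦc : Continuous Φ := by fun_prop
  have hsub : Ioc (-1 : ℝ) 1 ×ˢ Ioc (-1 : ℝ) 1 ⊆ Φ ⁻¹' Metric.closedBall 0 2 := by
    rintro ⟨s, t⟩ ⟨hs, ht⟩
    simp only [mem_Ioc] at hs ht
    rw [mem_preimage, mem_closedBall_zero_iff, EuclideanSpace.norm_eq,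
      Real.sqrt_le_left (by norm_num)]
    simp only [Φ, Fin.sum_univ_two, Real.norm_eq_abs, sq_abs]
    norm_num
    nlinarith
  have hcomp : IsCompact (Φ ⁻¹' Metric.closedBall 0 2) := by
    refine ((isCompact_Icc (a := (-2 : ℝ)) (b := 2)).prod
      (isCompact_Icc (a := (-2 : ℝ)) (b := 2))).of_isClosed_subset
      (Metric.isClosed_closedBall.preimage hΦc) ?_
    rintro ⟨s, t⟩ h
    rw [mem_preimage, mem_closedBall_zero_iff] at h
    have h0 := (PiLp.norm_apply_le (Φ (s, t)) 0).trans h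
    have h1 := (PiLp.norm_apply_le (Φ (s, t)) 1).trans h
    exact ⟨abs_le.1 h0, abs_le.1 h1⟩
  have hi : IntegrableOn (fun z => f (Φ z)) (Φ ⁻¹' Metric.closedBall 0 2) :=
    (hf.comp hΦc).continuousOn.integrableOn_compact hcomp
  calc ∫ s in (-1)..1, ∫ t in (-1)..1, f !₂[s, t]
      = ∫ s in Ioc (-1 : ℝ) 1, ∫ t in Ioc (-1 : ℝ) 1, f (Φ (s, t)) := by
        rw [intervalIntegral.integral_of_le (by norm_num)]
        simp_rw [intervalIntegral.integral_of_le (show (-1 : ℝ) ≤ 1 by norm_num)]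
        rfl
    _ = ∫ z in Ioc (-1 : ℝ) 1 ×ˢ Ioc (-1 : ℝ) 1, f (Φ z) :=
        (setIntegral_prod _ (hi.mono_set hsub)).symm
    _ ≤ ∫ z in Φ ⁻¹' Metric.closedBall 0 2, f (Φ z) :=
        setIntegral_mono_set hi (Eventually.of_forall fun _ => hf0 _) hsub.eventuallyLE
    _ = ∫ x in Metric.closedBall (0 : Plane) 2, f x := hΦ.setIntegral_preimage_emb hΦe f _

theorem intervalIntegral_swap_le_setIntegral_closedBall {f : Plane → ℝ} (hf : Continuous f)
    (hf0 : ∀ x, 0 ≤ f x) :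
    ∫ t in (-1)..1, ∫ s in (-1)..1, f !₂[s, t] ≤ ∫ x in Metric.closedBall (0 : Plane) 2, f x := by
  refine le_of_eq_of_le ?_ (intervalIntegral_le_setIntegral_closedBall hf hf0)
  simp_rw [intervalIntegral.integral_of_le (show (-1 : ℝ) ≤ 1 by norm_num)]
  refine integral_integral_swap ?_
  rw [Measure.prod_restrict]
  refine IntegrableOn.mono_set ?_ (prod_mono Ioc_subset_Icc_self Ioc_subset_Icc_self)
  refine ContinuousOn.integrableOn_compact (isCompact_Icc.prod isCompact_Icc) ?_
  exact (hf.comp (show Continuous fun z : ℝ × ℝ => (!₂[z.2, z.1] : Plane) by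
    fun_prop)).continuousOn

/-- Oscillation estimate at unit scale for the gradient of a `p`-harmonic function. -/
theorem PHarmonicOn.exists_unit_oscillation {p : ℝ} (hp : 1 < p) {ε : ℝ} (hε : 0 < ε) :
    ∃ δ, 0 < δ ∧ δ ≤ 1 ∧ ∀ (U : Set Plane) (u : Plane → ℝ), IsOpen U → PHarmonicOn p U u →
      Metric.closedBall 0 4 ⊆ U → (∀ x ∈ Metric.closedBall (0 : Plane) 4, ‖gradient u x‖ ≤ 1) →
      ∀ x, ‖x‖ < δ → ‖gradient u x - gradient u 0‖ ≤ ε := by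
  obtain ⟨r, hr, C, hC⟩ := exists_energy_estimate hp
  have hr0 : 0 < r - 1 := by linarith
  obtain ⟨q, hq, hrq⟩ : ∃ q, 1 < q ∧ (r - 1) * (q - 1) = 1 := by
    refine ⟨1 + 1 / (r - 1), by linarith [one_div_pos.2 hr0], ?_⟩
    field_simp
    ring
  have huc := (isCompact_closedBall (0 : Plane) 1).uniformContinuousOn_of_continuous
    (continuous_pFlux (V := Plane) hq).continuousOn
  obtain ⟨d, hd, hd'⟩ := Metric.uniformContinuousOn_iff.1 huc (ε / 2) (by positivity)
  obtain ⟨δ, hδ0, hδ1, hδ⟩ := exists_square_boundary_oscillation_le Plane (abs_nonneg C)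
    (show 0 < d / 16 by positivity)
  refine ⟨δ, hδ0, hδ1, fun U u hU hu h4 hg x hx => ?_⟩
  let χ : ContDiffBump (0 : Plane) := ⟨3, 4, by norm_num, by norm_num⟩
  have hχ0 : ∀ x, x ∉ Metric.closedBall (0 : Plane) 4 → χ x = 0 := fun x hx => by
    by_contra h
    exact hx (χ.tsupport_eq ▸ subset_tsupport _ h)
  have hG : Continuous fun x => χ x • pFlux r (gradient u x) := by
    refine ContinuousOn.continuous_of_eq_zero (U := U) (K := Metric.closedBall 0 4) ?_ hU
      Metric.isClosed_closedBall h4 fun x hx => by rw [hχ0 x hx, zero_smul]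
    exact χ.continuous.continuousOn.smul
      ((continuous_pFlux hr).comp_continuousOn (hu.1.continuousOn_gradient hU))
  set G : Plane → Plane := fun x => χ x • pFlux r (gradient u x) with hGdef
  have hG3 : ∀ x ∈ Metric.closedBall (0 : Plane) 3, G x = pFlux r (gradient u x) := fun x hx => by
    simp only [hGdef]
    rw [χ.one_of_mem_closedBall hx, one_smul]
  have hE : ∀ v : Plane, ‖v‖ ≤ 1 →
      ∫ x in Metric.closedBall (0 : Plane) 2, ‖G (x + v) - G x‖ ^ 2 ≤ |C| * ‖v‖ ^ 2 := by
    intro v hv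
    refine le_trans (le_of_eq ?_) ((hC U u hU hu h4 hg v hv).trans
      (mul_le_mul_of_nonneg_right (le_abs_self C) (by positivity)))
    refine setIntegral_congr_fun Metric.isClosed_closedBall.measurableSet fun x hx => ?_
    rw [mem_closedBall_zero_iff] at hx
    rw [hG3 x (by rw [mem_closedBall_zero_iff]; linarith),
      hG3 (x + v) (by rw [mem_closedBall_zero_iff]; linarith [norm_add_le x v])]
  obtain ⟨ρ, hδρ, hρ1, hρ⟩ := hδ (fun s t => G !₂[s, t]) (hG.comp (by fun_prop))
    (fun h h0 h1 => by
      have hv : ‖(!₂[0, h] : Plane)‖ = h := by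
        simp [EuclideanSpace.norm_eq, Real.sqrt_sq h0.le]
      have := hE !₂[0, h] (hv.trans_le h1)
      rw [hv] at this
      refine le_trans (le_of_eq ?_) ((intervalIntegral_le_setIntegral_closedBall
        (f := fun x => ‖G (x + !₂[0, h]) - G x‖ ^ 2) (by fun_prop)
        fun _ => by positivity).trans this)
      have e : ∀ s t : ℝ, (!₂[s, t + h] : Plane) = !₂[s, t] + !₂[0, h] := fun s t => by
        ext i
        fin_cases i <;> simp
      simp_rw [e])
    (fun h h0 h1 => by
      have hv : ‖(!₂[h, 0] : Plane)‖ = h := by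
        simp [EuclideanSpace.norm_eq, Real.sqrt_sq h0.le]
      have := hE !₂[h, 0] (hv.trans_le h1)
      rw [hv] at this
      refine le_trans (le_of_eq ?_) ((intervalIntegral_swap_le_setIntegral_closedBall
        (f := fun x => ‖G (x + !₂[h, 0]) - G x‖ ^ 2) (by fun_prop)
        fun _ => by positivity).trans this)
      have e : ∀ s t : ℝ, (!₂[s + h, t] : Plane) = !₂[s, t] + !₂[h, 0] := fun s t => by
        ext i
        fin_cases i <;> simp
      simp_rw [e])
  have hρ0 : 0 < ρ := hδ0.trans_le hδρ
  have heta : ∀ y : Plane, !₂[y 0, y 1] = y := fun y => by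
    ext i
    fin_cases i <;> simp
  have hnorm : ∀ y : Plane, |y 0| ≤ ρ → |y 1| ≤ ρ → ‖y‖ ≤ 2 := fun y h0 h1 => by
    rw [EuclideanSpace.norm_eq, Real.sqrt_le_left (by norm_num)]
    simp only [Fin.sum_univ_two, Real.norm_eq_abs]
    nlinarith [abs_nonneg (y 0), abs_nonneg (y 1)]
  set z : Plane := !₂[ρ, ρ] with hz
  have hz0 : |z 0| ≤ ρ := by simp [hz, abs_of_pos hρ0]
  have hz1 : |z 1| ≤ ρ := by simp [hz, abs_of_pos hρ0]
  have hinv : ∀ y : Plane, |y 0| ≤ ρ → |y 1| ≤ ρ → ‖G y‖ ≤ 1 ∧ pFlux q (G y) = gradient u y := by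
    intro y h0 h1
    have hy := hnorm y h0 h1
    rw [hG3 y (by rw [mem_closedBall_zero_iff]; linarith)]
    exact ⟨norm_pFlux_le_one hr (hg y (by rw [mem_closedBall_zero_iff]; linarith)),
      pFlux_pFlux hr hrq _⟩
  have hbd : ∀ y ∈ {y : Plane | |y 0| ≤ ρ ∧ |y 1| ≤ ρ} \ {y : Plane | |y 0| < ρ ∧ |y 1| < ρ},
      ‖gradient u y - gradient u z‖ ≤ ε / 2 := by
    rintro y ⟨⟨h0, h1⟩, hy⟩
    have hor : y 0 = ρ ∨ y 0 = -ρ ∨ y 1 = ρ ∨ y 1 = -ρ := by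
      by_contra! hcon
      refine hy ⟨lt_of_le_of_ne h0 fun h => ?_, lt_of_le_of_ne h1 fun h => ?_⟩
      · rcases eq_or_eq_neg_of_abs_eq h with h | h
        exacts [hcon.1 h, hcon.2.1 h]
      · rcases eq_or_eq_neg_of_abs_eq h with h | h
        exacts [hcon.2.2.1 h, hcon.2.2.2 h]
    have := hρ (y 0) (abs_le.1 h0) (y 1) (abs_le.1 h1) hor
    simp only [heta] at this
    rw [← (hinv y h0 h1).2, ← (hinv z hz0 hz1).2, ← dist_eq_norm]
    refine (hd' _ (mem_closedBall_zero_iff.2 (hinv y h0 h1).1) _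
      (mem_closedBall_zero_iff.2 (hinv z hz0 hz1).1) ?_).le
    rw [dist_eq_norm]
    linarith
  have hcoord : ∀ i, Continuous fun y : Plane => |y i| := fun i => by fun_prop
  have hK : IsCompact {y : Plane | |y 0| ≤ ρ ∧ |y 1| ≤ ρ} := by
    refine (isCompact_closedBall (0 : Plane) 2).of_isClosed_subset ?_ fun y hy =>
      mem_closedBall_zero_iff.2 (hnorm y hy.1 hy.2)
    exact (isClosed_le (hcoord 0) continuous_const).inter
      (isClosed_le (hcoord 1) continuous_const)
  have hD : IsOpen {y : Plane | |y 0| < ρ ∧ |y 1| < ρ} :=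
    (isOpen_lt (hcoord 0) continuous_const).inter (isOpen_lt (hcoord 1) continuous_const)
  have key : ∀ y : Plane, ‖y‖ < δ → ‖gradient u y - gradient u z‖ ≤ ε / 2 := fun y hy =>
    hu.norm_gradient_sub_le_of_boundary hp hU hD hK (fun y hy => ⟨hy.1.le, hy.2.le⟩)
      (fun y hy => h4 (mem_closedBall_zero_iff.2 (by linarith [hnorm y hy.1 hy.2]))) hbd
      ⟨((PiLp.norm_apply_le y 0).trans_lt hy).trans_le hδρ,
        ((PiLp.norm_apply_le y 1).trans_lt hy).trans_le hδρ⟩ (by positivity)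
  have k1 := key x hx
  have k2 := key 0 (by simpa using hδ0)
  rw [norm_sub_rev] at k2
  linarith [norm_sub_le_norm_sub_add_norm_sub (gradient u x) (gradient u z) (gradient u 0)]

theorem ContDiffOn.abs_sub_sub_inner_le {V : Type*} [NormedAddCommGroup V]
    [InnerProductSpace ℝ V] [CompleteSpace V] {f : V → ℝ} {U S : Set V} {b : V} {η : ℝ}
    (hf : ContDiffOn ℝ 1 f U) (hU : IsOpen U) (hS : Convex ℝ S) (hSU : S ⊆ U)
    (hη : ∀ x ∈ S, ‖gradient f x - b‖ ≤ η) {x y : V} (hx : x ∈ S) (hy : y ∈ S) :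
    |f y - f x - ⟪b, y - x⟫| ≤ η * ‖y - x‖ := by
  have := hS.norm_image_sub_le_of_norm_fderiv_le' (𝕜 := ℝ) (f := f)
    (φ := InnerProductSpace.toDual ℝ V b)
    (fun z hz => (hf.hasGradientAt hU (hSU hz)).differentiableAt)
    (fun z hz => by
      have e : fderiv ℝ f z = InnerProductSpace.toDual ℝ V (gradient f z) := by simp [gradient]
      rw [e, ← map_sub, LinearIsometryEquiv.norm_map]
      exact hη z hz) hx hy
  simpa using this

/-- If the gradients of `f` and `g` oscillate little on a ball, then their difference at the centre
is controlled by the uniform distance of `f` and `g`. -/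
theorem ContDiffOn.norm_gradient_sub_gradient_le {V : Type*} [NormedAddCommGroup V]
    [InnerProductSpace ℝ V] [CompleteSpace V] {f g : V → ℝ} {U : Set V} {x : V} {r ε τ : ℝ}
    (hf : ContDiffOn ℝ 1 f U) (hg : ContDiffOn ℝ 1 g U) (hU : IsOpen U) (hr : 0 < r)
    (hrU : Metric.closedBall x r ⊆ U)
    (hfε : ∀ y ∈ Metric.closedBall x r, ‖gradient f y - gradient f x‖ ≤ ε)
    (hgε : ∀ y ∈ Metric.closedBall x r, ‖gradient g y - gradient g x‖ ≤ ε)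
    (hτ : ∀ y ∈ Metric.closedBall x r, |f y - g y| ≤ τ) :
    ‖gradient f x - gradient g x‖ ≤ 2 * ε + 2 * τ / r := by
  set b := gradient f x - gradient g x with hb
  have hx : x ∈ Metric.closedBall x r := Metric.mem_closedBall_self hr.le
  have hε0 : 0 ≤ ε := (norm_nonneg _).trans (hfε x hx)
  have hτ0 : 0 ≤ τ := (abs_nonneg _).trans (hτ x hx)
  rcases eq_or_ne b 0 with h0 | h0
  · rw [h0, norm_zero]
    positivity
  have hbn : 0 < ‖b‖ := norm_pos_iff.2 h0
  set w : V := (r / ‖b‖) • b with hw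
  have hwn : ‖w‖ = r := by
    rw [hw, norm_smul, Real.norm_of_nonneg (by positivity), div_mul_cancel₀ _ hbn.ne']
  have hy : x + w ∈ Metric.closedBall x r := by simp [hwn]
  have hin : ⟪b, w⟫ = r * ‖b‖ := by
    rw [hw, real_inner_smul_right, real_inner_self_eq_norm_sq]
    field_simp
  have e1 := hf.abs_sub_sub_inner_le hU (convex_closedBall x r) hrU hfε hx hy
  have e2 := hg.abs_sub_sub_inner_le hU (convex_closedBall x r) hrU hgε hx hy
  rw [add_sub_cancel_left, hwn] at e1 e2
  have hin' : ⟪gradient f x, w⟫ - ⟪gradient g x, w⟫ = r * ‖b‖ := by rw [← inner_sub_left, ← hb, hin]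
  have t1 := hτ x hx
  have t2 := hτ _ hy
  rw [abs_le] at e1 e2 t1 t2
  have : ‖b‖ * r ≤ (2 * ε + 2 * τ / r) * r := by
    rw [add_mul, div_mul_cancel₀ _ hr.ne']
    linarith [e1.1, e1.2, e2.1, e2.2, t1.1, t1.2, t2.1, t2.2]
  exact le_of_mul_le_mul_right this hr

namespace PHarmonicOn

variable {p : ℝ}

theorem exists_oscillation (hp : 1 < p) {ε : ℝ} (hε : 0 < ε) :
    ∃ δ, 0 < δ ∧ δ ≤ 1 ∧ ∀ (U : Set Plane) (u : Plane → ℝ) (a : Plane) (R M : ℝ), IsOpen U →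
      PHarmonicOn p U u → 0 < R → 0 < M → Metric.closedBall a R ⊆ U →
      (∀ x ∈ Metric.closedBall a R, ‖gradient u x‖ ≤ M) →
      ∀ x, ‖x - a‖ < δ * R → ‖gradient u x - gradient u a‖ ≤ ε * M := by
  obtain ⟨δ, hδ0, hδ1, hδ⟩ := exists_unit_oscillation hp hε
  refine ⟨δ / 4, by positivity, by linarith, fun U u a R M hU hu hR hM hRU hg x hx => ?_⟩
  have hg' : ∀ y, gradient (fun y => 4 / (R * M) * u (a + (R / 4) • y)) y
      = (1 / M) • gradient u (a + (R / 4) • y) := by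
    intro y
    rw [gradient_const_mul _ (fun y => u (a + (R / 4) • y)), gradient_comp_affine, smul_smul]
    congr 1
    field_simp
  have hmem : ∀ y ∈ Metric.closedBall (0 : Plane) 4, a + (R / 4) • y ∈ Metric.closedBall a R := by
    intro y hy
    rw [mem_closedBall_zero_iff] at hy
    rw [mem_closedBall_iff_norm, add_sub_cancel_left, norm_smul,
      Real.norm_of_nonneg (by positivity)]
    nlinarith
  have key := hδ _ _ (hU.preimage (by fun_prop)) (hu.comp_affine a (s := R / 4)
    (c := 4 / (R * M)) (by positivity) (by positivity)) (fun y hy => hRU (hmem y hy))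
    (fun y hy => by
      rw [hg', norm_smul, Real.norm_of_nonneg (by positivity), one_div, inv_mul_le_iff₀ hM, mul_one]
      exact hg _ (hmem y hy))
    ((4 / R) • (x - a)) (by
      rw [norm_smul, Real.norm_of_nonneg (by positivity), div_mul_eq_mul_div, div_lt_iff₀ hR]
      linarith)
  have e : a + (R / 4) • ((4 / R) • (x - a)) = x := by
    rw [smul_smul, show R / 4 * (4 / R) = 1 by field_simp, one_smul, add_sub_cancel]
  rw [hg', hg', e, smul_zero, add_zero, ← smul_sub, norm_smul, Real.norm_of_nonneg (by positivity),
    one_div, inv_mul_le_iff₀ hM] at key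
  linarith

theorem exists_gradient_bound (hp : 1 < p) :
    ∃ C, 0 < C ∧ ∀ (U : Set Plane) (u : Plane → ℝ) (a : Plane) (R A : ℝ), IsOpen U →
      PHarmonicOn p U u → 0 < R → Metric.closedBall a R ⊆ U →
      (∀ x ∈ Metric.closedBall a R, |u x| ≤ A) → R * ‖gradient u a‖ ≤ C * A := by
  obtain ⟨δ, hδ0, hδ1, hδ⟩ := exists_oscillation hp (ε := 1 / 4) (by norm_num)
  refine ⟨16 / δ, by positivity, fun U u a R A hU hu hR hRU hA => ?_⟩
  have ha : a ∈ Metric.closedBall a R := Metric.mem_closedBall_self hR.le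
  have hA0 : 0 ≤ A := (abs_nonneg _).trans (hA a ha)
  have hcont : ContinuousOn (fun x => (R - ‖x - a‖) * ‖gradient u x‖) (Metric.closedBall a R) :=
    ContinuousOn.mul (by fun_prop) ((hu.1.continuousOn_gradient hU).mono hRU).norm
  obtain ⟨x, hx, hmax⟩ := (isCompact_closedBall a R).exists_isMaxOn ⟨a, ha⟩ hcont
  have hT : R * ‖gradient u a‖ ≤ (R - ‖x - a‖) * ‖gradient u x‖ := by simpa using hmax ha
  set m := ‖gradient u x‖ with hm
  set d := R - ‖x - a‖ with hd
  have hd0 : 0 ≤ d := by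
    rw [mem_closedBall_iff_norm] at hx
    linarith
  have hm0 : 0 ≤ m := norm_nonneg _
  rcases hd0.eq_or_lt with h0 | hd0
  · rw [← h0, zero_mul] at hT
    exact hT.trans (by positivity)
  rcases hm0.eq_or_lt with h0 | hm0
  · rw [← h0, mul_zero] at hT
    exact hT.trans (by positivity)
  have hsub : ∀ y ∈ Metric.closedBall x (d / 2),
      y ∈ Metric.closedBall a R ∧ d / 2 ≤ R - ‖y - a‖ := by
    intro y hy
    rw [mem_closedBall_iff_norm] at hy ⊢
    have := norm_sub_le_norm_sub_add_norm_sub y x a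
    constructor <;> linarith
  have hg : ∀ y ∈ Metric.closedBall x (d / 2), ‖gradient u y‖ ≤ 2 * m := by
    intro y hy
    have h1 : (R - ‖y - a‖) * ‖gradient u y‖ ≤ d * m := hmax (hsub y hy).1
    have h2 : d / 2 * ‖gradient u y‖ ≤ d / 2 * (2 * m) :=
      (mul_le_mul_of_nonneg_right (hsub y hy).2 (norm_nonneg _)).trans (h1.trans_eq (by ring))
    exact le_of_mul_le_mul_left h2 (by positivity)
  have hosc := hδ U u x (d / 2) (2 * m) hU hu (by positivity) (by positivity)
    (fun y hy => hRU (hsub y hy).1) hg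
  set s := δ * d / 4 with hs
  have hs0 : 0 < s := by positivity
  have hsd : s ≤ d / 2 := by nlinarith
  have hball : Metric.closedBall x s ⊆ Metric.closedBall x (d / 2) :=
    Metric.closedBall_subset_closedBall hsd
  set w : Plane := (s / m) • gradient u x with hw
  have hwn : ‖w‖ = s := by
    rw [hw, norm_smul, Real.norm_of_nonneg (by positivity), ← hm, div_mul_cancel₀ _ hm0.ne']
  have hin : ⟪gradient u x, w⟫ = s * m := by
    rw [hw, real_inner_smul_right, real_inner_self_eq_norm_sq, ← hm]
    field_simp
  have hxs : x ∈ Metric.closedBall x s := Metric.mem_closedBall_self hs0.le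
  have hys : x + w ∈ Metric.closedBall x s := by simp [hwn]
  have e := hu.1.abs_sub_sub_inner_le hU (convex_closedBall x s)
    (fun y hy => hRU (hsub y (hball hy)).1) (η := 1 / 4 * (2 * m)) (b := gradient u x)
    (fun y hy => hosc y (by
      rw [mem_closedBall_iff_norm] at hy
      have : 0 < δ * d := by positivity
      linarith)) hxs hys
  rw [add_sub_cancel_left, hwn, hin, abs_le] at e
  have a1 := abs_le.1 (hA x hx)
  have a2 := abs_le.1 (hA _ (hsub _ (hball hys)).1)
  have hfin : s * m / 2 ≤ 2 * A := by linarith [e.1, a1.1, a2.2]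
  refine hT.trans ?_
  rw [div_mul_eq_mul_div, le_div_iff₀ hδ0]
  rw [hs] at hfin
  linarith

theorem exists_equicontinuity (hp : 1 < p) {ε A R : ℝ} (hε : 0 < ε) (hA : 0 ≤ A) (hR : 0 < R) :
    ∃ r, 0 < r ∧ r ≤ R ∧ ∀ (U : Set Plane) (u : Plane → ℝ) (a : Plane), IsOpen U →
      PHarmonicOn p U u → Metric.closedBall a (2 * R) ⊆ U →
      (∀ x ∈ Metric.closedBall a (2 * R), |u x| ≤ A) →
      ∀ x ∈ Metric.closedBall a r, ‖gradient u x - gradient u a‖ ≤ ε := by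
  obtain ⟨C, hC0, hC⟩ := exists_gradient_bound hp
  set M := C * A / R + 1 with hM
  have hM0 : 0 < M := by positivity
  obtain ⟨δ, hδ0, hδ1, hδ⟩ := exists_oscillation hp (ε := ε / M) (by positivity)
  refine ⟨δ * R / 2, by positivity, by nlinarith, fun U u a hU hu hRU hA x hx => ?_⟩
  have hsub : ∀ z ∈ Metric.closedBall a R, Metric.closedBall z R ⊆ Metric.closedBall a (2 * R) :=
    fun z hz => Metric.closedBall_subset_closedBall' (by linarith [Metric.mem_closedBall.1 hz])
  have hg : ∀ z ∈ Metric.closedBall a R, ‖gradient u z‖ ≤ M := by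
    intro z hz
    have := hC U u z R A hU hu hR ((hsub z hz).trans hRU) fun y hy => hA y (hsub z hz hy)
    have h2 : ‖gradient u z‖ ≤ C * A / R := by
      rw [le_div_iff₀ hR]
      linarith
    linarith
  have := hδ U u a R M hU hu hR hM0
    ((Metric.closedBall_subset_closedBall (by linarith)).trans hRU) hg x (by
      rw [mem_closedBall_iff_norm] at hx
      have : 0 < δ * R := by positivity
      linarith)
  rwa [div_mul_cancel₀ _ hM0.ne'] at this

theorem exists_uniformCauchySeqOn_gradient (hp : 1 < p) {U : Set Plane} (hU : IsOpen U)
    {φn : ℕ → Plane → ℝ} (hφn : ∀ n, PHarmonicOn p U (φn n)) {φ : Plane → ℝ}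
    (hconv : TendstoLocallyUniformlyOn φn φ atTop U) {a : Plane} (ha : a ∈ U) :
    ∃ R > 0, UniformCauchySeqOn (fun n x => gradient (φn n) x) atTop (Metric.closedBall a R) := by
  obtain ⟨R₀, hR₀, hR₀U⟩ := Metric.nhds_basis_closedBall.mem_iff.1 (hU.mem_nhds ha)
  set R := R₀ / 3 with hR
  have hR0 : 0 < R := by positivity
  have h3 : 3 * R = R₀ := by rw [hR]; ring
  have hsub : ∀ x ∈ Metric.closedBall a R, Metric.closedBall x (2 * R) ⊆ Metric.closedBall a R₀ :=
    fun x hx => Metric.closedBall_subset_closedBall' (by linarith [Metric.mem_closedBall.1 hx])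
  have hcont : ContinuousOn φ U :=
    hconv.continuousOn (Frequently.of_forall fun n => (hφn n).1.continuousOn)
  obtain ⟨A, hA⟩ := (isCompact_closedBall a R₀).exists_bound_of_continuousOn (hcont.mono hR₀U)
  have hA0 : 0 ≤ A := (norm_nonneg _).trans (hA a (Metric.mem_closedBall_self hR₀.le))
  have hunif : TendstoUniformlyOn φn φ atTop (Metric.closedBall a R₀) :=
    (tendstoLocallyUniformlyOn_iff_forall_isCompact hU).1 hconv _ hR₀U (isCompact_closedBall a R₀)
  rw [Metric.tendstoUniformlyOn_iff] at hunif
  refine ⟨R, hR0, Metric.uniformCauchySeqOn_iff.2 fun ε hε => ?_⟩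
  obtain ⟨r, hr0, hrR, hr⟩ := exists_equicontinuity hp (ε := ε / 8) (A := A + 1) (by positivity)
    (by positivity) hR0
  obtain ⟨N, hN⟩ := eventually_atTop.1 ((hunif 1 one_pos).and
    (hunif (ε * r / 16) (by positivity)))
  have hosc : ∀ n ≥ N, ∀ x ∈ Metric.closedBall a R, ∀ y ∈ Metric.closedBall x r,
      ‖gradient (φn n) y - gradient (φn n) x‖ ≤ ε / 8 := by
    intro n hn x hx
    refine hr U (φn n) x hU (hφn n) ((hsub x hx).trans hR₀U) fun y hy => ?_
    have h1 := (hN n hn).1 y (hsub x hx hy)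
    have h2 := hA y (hsub x hx hy)
    rw [Real.dist_eq] at h1
    rw [Real.norm_eq_abs] at h2
    have h3 := abs_sub_abs_le_abs_sub (φn n y) (φ y)
    rw [abs_sub_comm] at h3
    linarith
  refine ⟨N, fun m hm n hn x hx => ?_⟩
  have hrs : Metric.closedBall x r ⊆ Metric.closedBall a R₀ :=
    (Metric.closedBall_subset_closedBall (by linarith)).trans (hsub x hx)
  have := (hφn m).1.norm_gradient_sub_gradient_le (hφn n).1 hU hr0 (hrs.trans hR₀U)
    (hosc m hm x hx) (hosc n hn x hx) (τ := ε * r / 8) fun y hy => by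
      have h1 := (hN m hm).2 y (hrs hy)
      have h2 := (hN n hn).2 y (hrs hy)
      rw [Real.dist_eq, abs_lt] at h1 h2
      rw [abs_le]
      constructor <;> linarith
  rw [dist_eq_norm]
  have e : 2 * (ε * r / 8) / r = ε / 4 := by
    field_simp
    ring
  linarith

theorem of_tendstoLocallyUniformlyOn_gradient (hp : 1 < p) {U : Set Plane} (hU : IsOpen U)
    {φn : ℕ → Plane → ℝ} (hφn : ∀ n, PHarmonicOn p U (φn n)) {φ : Plane → ℝ}
    (hφ : ContDiffOn ℝ 1 φ U) (hg : TendstoLocallyUniformlyOn (fun n x => gradient (φn n) x)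
      (fun x => gradient φ x) atTop U) : PHarmonicOn p U φ := by
  refine ⟨hφ, fun η hη hc hs => ?_⟩
  have hη0 : ∀ x, x ∉ tsupport η → gradient η x = 0 := fun x hx => gradient_of_notMem_tsupport hx
  have hηc := hη.continuous_gradient
  have hK : IsCompact (tsupport η) := hc
  obtain ⟨B, hB⟩ := hK.exists_bound_of_continuousOn ((hφ.continuousOn_gradient hU).mono hs)
  have hunif := (tendstoLocallyUniformlyOn_iff_forall_isCompact hU).1 hg _ hs hK
  rw [Metric.tendstoUniformlyOn_iff] at hunif
  have hlim : Tendsto (fun n => ∫ x, ⟪pFlux p (gradient (φn n) x), gradient η x⟫) atTop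
      (nhds (∫ x, ⟪pFlux p (gradient φ x), gradient η x⟫)) := by
    refine tendsto_integral_filter_of_dominated_convergence
      (fun x => (B + 1) ^ (p - 1) * ‖gradient η x‖) ?_ ?_ ?_ ?_
    · exact Eventually.of_forall fun n =>
        ((hφn n).integrable_inner hp hU hηc.continuousOn hK hs hη0).aestronglyMeasurable
    · filter_upwards [hunif 1 one_pos] with n hn
      refine Eventually.of_forall fun x => ?_
      by_cases hx : x ∈ tsupport η
      · refine (norm_inner_le_norm _ _).trans (mul_le_mul_of_nonneg_right ?_ (norm_nonneg _))
        rw [norm_pFlux hp]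
        refine Real.rpow_le_rpow (norm_nonneg _) ?_ (by linarith)
        have h1 := hn x hx
        rw [dist_comm, dist_eq_norm] at h1
        linarith [hB x hx, norm_sub_norm_le (gradient (φn n) x) (gradient φ x)]
      · simp [hη0 x hx]
    · exact ((hηc.integrable_of_hasCompactSupport
        (HasCompactSupport.intro hK fun x hx => hη0 x hx)).norm).const_mul _
    · refine Eventually.of_forall fun x => ?_
      by_cases hx : x ∈ tsupport η
      · exact (((continuous_pFlux hp).tendsto _).comp
          (hg.tendsto_at (hs hx))).inner tendsto_const_nhds
      · simp [hη0 x hx]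
  have h0 : ∫ x, ⟪pFlux p (gradient φ x), gradient η x⟫ = 0 := by
    refine tendsto_nhds_unique hlim ?_
    simp only [fun n => (hφn n).integral_eq_zero hη hc hs]
    exact tendsto_const_nhds
  rw [← h0, setIntegral_eq_integral_of_forall_compl_eq_zero]
  · simp only [pFlux, real_inner_smul_left]
  · intro x hx
    rw [hη0 x fun h => hx (hs h), inner_zero_right, mul_zero]

end PHarmonicOn

/-- Stability of `p`-harmonicity under locally uniform convergence, together with
locally uniform convergence of the gradients (a consequence of interior `C^{1,α}`
estimates for `p`-harmonic functions). -/
theorem pharmonic_locally_uniform_limit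
    (p : ℝ) (hp : 1 < p)
    (Ω : Set (EuclideanSpace ℝ (Fin 2))) (hΩne : Ω.Nonempty) (hΩo : IsOpen Ω)
    (φn : ℕ → EuclideanSpace ℝ (Fin 2) → ℝ)
    (hφn : ∀ n, PHarmonicOn p Ω (φn n))
    (φ : EuclideanSpace ℝ (Fin 2) → ℝ)
    (hconv : TendstoLocallyUniformlyOn (fun n => φn n) φ atTop Ω) :
    PHarmonicOn p Ω φ ∧
    TendstoLocallyUniformlyOn (fun n x => gradient (φn n) x)
      (fun x => gradient φ x) atTop Ω := by
  have hlim : ∀ x ∈ Ω, ∃ b, Tendsto (fun n => gradient (φn n) x) atTop (nhds b) := fun x hx => by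
    obtain ⟨R, hR, hC⟩ := PHarmonicOn.exists_uniformCauchySeqOn_gradient hp hΩo hφn hconv hx
    exact cauchySeq_tendsto_of_complete (hC.cauchySeq (Metric.mem_closedBall_self hR.le))
  choose! g hg using hlim
  have hgl : TendstoLocallyUniformlyOn (fun n x => gradient (φn n) x) g atTop Ω := by
    rw [Metric.tendstoLocallyUniformlyOn_iff]
    intro ε hε a ha
    obtain ⟨R, hR, hC⟩ := PHarmonicOn.exists_uniformCauchySeqOn_gradient hp hΩo hφn hconv ha
    have hu := (hC.mono inter_subset_left).tendstoUniformlyOn_of_tendsto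
      (s := Metric.closedBall a R ∩ Ω) (f := g) fun x hx => hg x hx.2
    exact ⟨_, inter_mem (mem_nhdsWithin_of_mem_nhds (Metric.closedBall_mem_nhds a hR))
      self_mem_nhdsWithin, Metric.tendstoUniformlyOn_iff.1 hu ε hε⟩
  have hder : ∀ x ∈ Ω, HasGradientAt φ (g x) x := fun x hx =>
    hasFDerivAt_of_tendstoLocallyUniformlyOn hΩo
      ((InnerProductSpace.toDual ℝ Plane).isometry.uniformContinuous.comp_tendstoLocallyUniformlyOn
        hgl) (fun n y hy => (hφn n).1.hasGradientAt hΩo hy)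
      (fun y hy => hconv.tendsto_at hy) hx
  have hgrad : ∀ x ∈ Ω, gradient φ x = g x := fun x hx => (hder x hx).gradient
  have hgc : ContinuousOn g Ω :=
    hgl.continuousOn (Frequently.of_forall fun n => (hφn n).1.continuousOn_gradient hΩo)
  have hφ : ContDiffOn ℝ 1 φ Ω := by
    rw [show (1 : WithTop ℕ∞) = 0 + 1 from rfl, contDiffOn_succ_iff_fderiv_of_isOpen hΩo,
      contDiffOn_zero]
    refine ⟨fun x hx => (hder x hx).differentiableAt.differentiableWithinAt, by simp, ?_⟩
    exact ((InnerProductSpace.toDual ℝ Plane).continuous.comp_continuousOn hgc).congr fun x hx =>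
      (hder x hx).hasFDerivAt.fderiv
  have hgl' := hgl.congr_right fun x hx => (hgrad x hx).symm
  exact ⟨PHarmonicOn.of_tendstoLocallyUniformlyOn_gradient hp hΩo hφn hφ hgl', hgl'⟩
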